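/- arXiv:math/0505315 — 3 statements merged into one kernel-verified Lean document; each statement's English description precedes it below -/
import Mathlib

section
/- Let K be a unique factorization domain and X the generic 3×3 matrix over K, with entries in S = K[x_{ij} : 1 ≤ i,j ≤ 3]. Then there are no nontrivial factorizations of adj(X): whenever Y and Z are 3×3 matrices over S with adj(X) = Y·Z, either Y is invertible over S or Z is invertible over S. -/
open Matrix

/-- The generic `3 × 3` matrix, whose `(i,j)` entry is the indeterminate `x_{ij}` of the
polynomial ring `S = K[x_{ij} : 1 ≤ i,j ≤ 3]`. -/
noncomputable def genericMatrix3 (K : Type*) [CommRing K] :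
    Matrix (Fin 3) (Fin 3) (MvPolynomial (Fin 3 × Fin 3) K) :=
  Matrix.of fun i j => MvPolynomial.X (i, j)

open MvPolynomial in
/-- The determinant of the generic `3 × 3` matrix over a domain is irreducible. -/
theorem irreducible_det_genericMatrix3 (K : Type*) [CommRing K] [IsDomain K] :
    Irreducible (genericMatrix3 K).det := by
  let x : Fin 3 → Fin 3 → MvPolynomial (Fin 3 × Fin 3) K := fun i j => X (i, j)
  have hmem : ∀ (v i j), (i, j) ≠ v → x i j ∈ supported K {v}ᶜ := fun v i j h => by
    simpa [x, X_mem_supported] using h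
  have hvars : ∀ (v) (p : MvPolynomial (Fin 3 × Fin 3) K), p ∈ supported K {v}ᶜ → v ∉ p.vars := by
    intro v p hp hv
    exact (mem_supported.1 hp hv) rfl
  have hminor : Irreducible (x 2 2 * X (1, 1) + -(x 1 2 * x 2 1)) := by
    refine irreducible_mul_X_add _ _ _ (X_ne_zero _) (hvars _ _ (hmem _ _ _ (by decide)))
      (hvars _ _ (neg_mem (mul_mem (hmem _ _ _ (by decide)) (hmem _ _ _ (by decide))))) ?_
    refine (X_prime (R := K)).irreducible.isRelPrime_iff_not_dvd.2 fun h => ?_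
    have := map_dvd (eval fun p : Fin 3 × Fin 3 => if p = (2, 2) then (0 : K) else 1) h
    simp [x] at this
  have hdet : (genericMatrix3 K).det = (x 2 2 * X (1, 1) + -(x 1 2 * x 2 1)) * X (0, 0) +
      (-(x 0 1 * (x 1 0 * x 2 2 - x 1 2 * x 2 0)) + x 0 2 * (x 1 0 * x 2 1 - x 1 1 * x 2 0)) := by
    simp only [det_fin_three, genericMatrix3, of_apply, x]
    ring
  rw [hdet]
  refine irreducible_mul_X_add _ _ _ hminor.ne_zero (hvars _ _ ?_) (hvars _ _ ?_)
    (hminor.isRelPrime_iff_not_dvd.2 fun h => ?_)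
  · exact add_mem (mul_mem (hmem _ _ _ (by decide)) (hmem _ 1 1 (by decide)))
      (neg_mem (mul_mem (hmem _ _ _ (by decide)) (hmem _ _ _ (by decide))))
  · refine add_mem (neg_mem (mul_mem (hmem _ _ _ ?_) (sub_mem (mul_mem (hmem _ _ _ ?_)
      (hmem _ _ _ ?_)) (mul_mem (hmem _ _ _ ?_) (hmem _ _ _ ?_))))) (mul_mem (hmem _ _ _ ?_)
      (sub_mem (mul_mem (hmem _ _ _ ?_) (hmem _ _ _ ?_)) (mul_mem (hmem _ _ _ ?_)
      (hmem _ _ _ ?_)))) <;> decide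
  · have := map_dvd (eval fun p : Fin 3 × Fin 3 =>
      if p = (0, 2) ∨ p = (1, 0) ∨ p = (2, 1) then (1 : K) else 0) h
    simp [x] at this

theorem Matrix.det_add_smul_fin_three {R : Type*} [CommRing R] (A B : Matrix (Fin 3) (Fin 3) R)
    (t : R) : (A + t • B).det =
      A.det + t * (A.adjugate * B).trace + t ^ 2 * (A * B.adjugate).trace + t ^ 3 * B.det := by
  simp [det_fin_three, adjugate_fin_three, trace_fin_three, Matrix.mul_apply, vecMul, dotProduct,
    Fin.sum_univ_three]
  ring

section LinearPreserver

variable {L : Type*} [Field L] {f : Matrix (Fin 3) (Fin 3) L →ₗ[L] Matrix (Fin 3) (Fin 3) L} {c : L}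

theorem trace_adjugate_mul_of_det_map [Infinite L] (hf : ∀ M, (f M).det = c * M.det)
    (A B : Matrix (Fin 3) (Fin 3) L) :
    ((f A).adjugate * f B).trace = c * (A.adjugate * B).trace := by
  classical
  obtain ⟨t, ht⟩ := Infinite.exists_notMem_finset ({0, 1} : Finset L)
  simp only [Finset.mem_insert, Finset.mem_singleton, not_or] at ht
  have key : ∀ s : L, s * (((f A).adjugate * f B).trace - c * (A.adjugate * B).trace) +
      s ^ 2 * ((f A * (f B).adjugate).trace - c * (A * B.adjugate).trace) = 0 := by
    intro s
    have h := hf (A + s • B)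
    rw [map_add, map_smul, det_add_smul_fin_three, det_add_smul_fin_three, hf, hf] at h
    linear_combination h
  have h1 := key 1
  have ht' : t * (t - 1) ≠ 0 := mul_ne_zero ht.1 (sub_ne_zero.2 ht.2)
  refine sub_eq_zero.1 ((mul_eq_zero.1 ?_).resolve_left ht')
  linear_combination t ^ 2 * h1 - key t

theorem eq_zero_of_trace_adjugate_mul {N : Matrix (Fin 3) (Fin 3) L}
    (h : ∀ A : Matrix (Fin 3) (Fin 3) L, (A.adjugate * N).trace = 0) : N = 0 := by
  have h00 := h !![0, 0, 0; 0, 1, 0; 0, 0, 1]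
  have h11 := h !![1, 0, 0; 0, 0, 0; 0, 0, 1]
  have h22 := h !![1, 0, 0; 0, 1, 0; 0, 0, 0]
  have h01 := h !![0, 1, 0; 0, 0, 0; 0, 0, 1]
  have h10 := h !![0, 0, 0; 1, 0, 0; 0, 0, 1]
  have h02 := h !![0, 0, 1; 0, 1, 0; 0, 0, 0]
  have h20 := h !![0, 0, 0; 0, 1, 0; 1, 0, 0]
  have h12 := h !![1, 0, 0; 0, 0, 1; 0, 0, 0]
  have h21 := h !![1, 0, 0; 0, 0, 0; 0, 1, 0]
  simp [adjugate_fin_three, trace_fin_three, vecMul, dotProduct, Fin.sum_univ_three]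
    at h00 h11 h22 h01 h10 h02 h20 h12 h21
  ext i j
  fin_cases i <;> fin_cases j <;> simpa

theorem adjugate_map_eq_zero [Infinite L] (hc : c ≠ 0) (hf : ∀ M, (f M).det = c * M.det)
    {A : Matrix (Fin 3) (Fin 3) L} (hA : A.adjugate = 0) : (f A).adjugate = 0 := by
  have hinj : Function.Injective f := by
    refine (injective_iff_map_eq_zero f).2 fun N hN => eq_zero_of_trace_adjugate_mul fun A => ?_
    simpa [hN, hc] using (trace_adjugate_mul_of_det_map hf A N).symm
  have hsurj := LinearMap.injective_iff_surjective.1 hinj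
  refine Matrix.ext_iff_trace_mul_right.2 fun P => ?_
  obtain ⟨B, rfl⟩ := hsurj P
  simp [trace_adjugate_mul_of_det_map hf, hA]

theorem adjugate_vecMulVec_fin_three (v w : Fin 3 → L) : (vecMulVec v w).adjugate = 0 := by
  ext i j
  fin_cases i <;> fin_cases j <;> simp [adjugate_fin_three, vecMulVec_apply] <;> ring

theorem det_add_add_eq_zero_of_adjugate_eq_zero {A B C D E : Matrix (Fin 3) (Fin 3) L}
    (hA0 : ∀ b, A 0 b = 0) (hB1 : ∀ b, B 1 b = 0) (hC2 : ∀ b, C 2 b = 0)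
    (hCD : ∀ b, C 0 b = -D 2 b) (hCE : ∀ b, C 1 b = -E 2 b) (hDE : ∀ b, E 0 b = -D 1 b)
    (hA : A.adjugate = 0) (hB : B.adjugate = 0) (hC : C.adjugate = 0) (hD : D.adjugate = 0)
    (hE : E.adjugate = 0) (hAD : (A + D).adjugate = 0) (hBE : (B + E).adjugate = 0) :
    (A + B + C).det = 0 := by
  have entry : ∀ {M : Matrix (Fin 3) (Fin 3) L}, M.adjugate = 0 → ∀ i j, M.adjugate i j = 0 :=
    fun h i j => by rw [h, Matrix.zero_apply]
  have a0 := entry hA 0 0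
  have a1 := entry hA 1 0
  have a2 := entry hA 2 0
  have b0 := entry hB 0 1
  have b1 := entry hB 1 1
  have b2 := entry hB 2 1
  have c0 := entry hC 0 2
  have c1 := entry hC 1 2
  have c2 := entry hC 2 2
  have d0 := entry hD 0 0
  have d1 := entry hD 1 0
  have d2 := entry hD 2 0
  have e0 := entry hE 0 1
  have e1 := entry hE 1 1
  have e2 := entry hE 2 1
  have p0 := entry hAD 0 0
  have p1 := entry hAD 1 0
  have p2 := entry hAD 2 0
  have q0 := entry hBE 0 1
  have q1 := entry hBE 1 1
  have q2 := entry hBE 2 1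
  simp only [adjugate_fin_three, of_apply, cons_val, Matrix.add_apply, hCD, hCE, hDE]
    at a0 a1 a2 b0 b1 b2 c0 c1 c2 d0 d1 d2 e0 e1 e2 p0 p1 p2 q0 q1 q2
  simp only [det_fin_three, Matrix.add_apply, hA0, hB1, hC2, hCD, hCE]
  linear_combination B 2 0 * (p0 - a0 - d0) + B 2 1 * (p1 - a1 - d1) + B 2 2 * (p2 - a2 - d2) +
    A 2 0 * (q0 - b0 - e0) + A 2 1 * (q1 - b1 - e1) + A 2 2 * (q2 - b2 - e2) +
    (B 0 0 - D 2 0) * a0 + (B 0 1 - D 2 1) * a1 + (B 0 2 - D 2 2) * a2 +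
    (A 2 0 + B 2 0) * c0 + (A 2 1 + B 2 1) * c1 + (A 2 2 + B 2 2) * c2 -
    (E 2 0 - A 1 0) * b0 - (E 2 1 - A 1 1) * b1 - (E 2 2 - A 1 2) * b2

/-- There are no linear maps `f`, `g` on `3 × 3` matrices, both scaling the determinant by nonzero
constants, such that `M * f M` is proportional to the adjugate of `g M` for all `M`. -/
theorem false_of_linear_factorization [Infinite L]
    {g : Matrix (Fin 3) (Fin 3) L →ₗ[L] Matrix (Fin 3) (Fin 3) L} {d e : L}
    (hc : c ≠ 0) (hd : d ≠ 0) (he : e ≠ 0) (hf : ∀ M, (f M).det = c * M.det)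
    (hg : ∀ M, (g M).det = d * M.det) (hfg : ∀ M, e • (M * f M) = (g M).adjugate) : False := by
  have hadj : ∀ v w, (f (vecMulVec v w)).adjugate = 0 := fun v w =>
    adjugate_map_eq_zero hc hf (adjugate_vecMulVec_fin_three v w)
  have hrow : ∀ i w, w ᵥ* f (vecMulVec (Pi.single i 1) w) = 0 := by
    intro i w
    have h := hfg (vecMulVec (Pi.single i 1) w)
    rw [adjugate_map_eq_zero hd hg (adjugate_vecMulVec_fin_three _ _), smul_eq_zero_iff_right he,
      vecMulVec_mul] at h
    ext b
    simpa [vecMulVec_apply] using congr_fun₂ h i b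
  obtain ⟨r, hr⟩ : ∃ r : Fin 3 → Fin 3 → Matrix (Fin 3) (Fin 3) L,
      ∀ i j, r i j = f (vecMulVec (Pi.single i 1) (Pi.single j 1)) := ⟨_, fun _ _ => rfl⟩
  have hself : ∀ i j b, r i j j b = 0 := by
    intro i j b
    simpa [hr] using congr_fun (hrow i (Pi.single j 1)) b
  have hswap : ∀ i j k b, r i j k b = -r i k j b := by
    intro i j k b
    have h := congr_fun (hrow i (Pi.single j 1 + Pi.single k 1)) b
    simp only [vecMulVec_add, map_add, add_vecMul, vecMul_add, single_one_vecMul, row_apply,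
      Pi.add_apply, Pi.zero_apply, ← hr, hself] at h
    linear_combination h
  have hminor : ∀ i j, (r i j).adjugate = 0 := fun i j => hr i j ▸ hadj _ _
  have hpolar : ∀ i k j, (r i j + r k j).adjugate = 0 := fun i k j => by
    rw [hr, hr, ← map_add, ← add_vecMulVec]
    exact hadj _ _
  have hone : r 0 0 + r 1 1 + r 2 2 = f 1 := by
    rw [hr, hr, hr, ← map_add, ← map_add]
    congr 1
    ext i j
    fin_cases i <;> fin_cases j <;> simp [vecMulVec_apply]
  have hdet := hf 1
  rw [← hone, det_one, mul_one] at hdet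
  exact hc (hdet.symm.trans (det_add_add_eq_zero_of_adjugate_eq_zero (hself 0 0) (hself 1 1)
    (hself 2 2) (hswap 2 2 0) (hswap 2 2 1) (hswap 2 1 0) (hminor 0 0) (hminor 1 1) (hminor 2 2)
    (hminor 2 0) (hminor 2 1) (hpolar 0 2 0) (hpolar 1 2 1)))

end LinearPreserver

section LineEval

open Polynomial

variable {K L : Type*} [CommRing K] [Field L] [Algebra K L]

/-- Evaluation of polynomials in the matrix entries at the points `t • M` of the line through `M`,
where `t` is the indeterminate of `L[X]`. -/
noncomputable def lineEval (M : Matrix (Fin 3) (Fin 3) L) :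
    MvPolynomial (Fin 3 × Fin 3) K →ₐ[K] L[X] :=
  MvPolynomial.aeval fun p => C (M p.1 p.2) * X

theorem lineEval_genericMatrix3 (M : Matrix (Fin 3) (Fin 3) L) :
    (lineEval M).mapMatrix (genericMatrix3 K) = (X : L[X]) • C.mapMatrix M := by
  ext1 i j
  simp [lineEval, genericMatrix3, mul_comm X]

theorem eval_zero_lineEval (M : Matrix (Fin 3) (Fin 3) L) (p : MvPolynomial (Fin 3 × Fin 3) K) :
    (lineEval M p).eval 0 = algebraMap K L (MvPolynomial.constantCoeff p) := by
  induction p using MvPolynomial.induction_on with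
  | C a => simp [lineEval, Polynomial.algebraMap_apply]
  | add p q hp hq => simp [hp, hq]
  | mul_X p i _ => simp [lineEval]

/-- The homogeneous part of degree one of a polynomial without constant term. -/
theorem exists_linear_part {p : MvPolynomial (Fin 3 × Fin 3) K}
    (hp : MvPolynomial.constantCoeff p = 0) :
    ∃ φ : Matrix (Fin 3) (Fin 3) L →ₗ[L] L, ∀ M, ∃ q : L[X], lineEval M p = X * q ∧
      q.eval 0 = φ M := by
  have hmem : p ∈ MvPolynomial.idealOfVars (Fin 3 × Fin 3) K := by
    rw [← pow_one (MvPolynomial.idealOfVars _ _), MvPolynomial.mem_pow_idealOfVars_iff']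
    intro x hx
    rwa [(Finsupp.degree_eq_zero_iff x).1 (Nat.lt_one_iff.1 hx)]
  clear hp
  induction hmem using Submodule.span_induction with
  | mem p h =>
    obtain ⟨⟨i, j⟩, rfl⟩ := h
    exact ⟨Matrix.entryLinearMap L L i j, fun M => ⟨C (M i j), by
      rw [lineEval, MvPolynomial.aeval_X, mul_comm], by simp⟩⟩
  | zero => exact ⟨0, fun M => ⟨0, by simp⟩⟩
  | add p q _ _ hp hq =>
    obtain ⟨φ, hφ⟩ := hp
    obtain ⟨ψ, hψ⟩ := hq
    refine ⟨φ + ψ, fun M => ?_⟩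
    obtain ⟨a, ha, ha'⟩ := hφ M
    obtain ⟨b, hb, hb'⟩ := hψ M
    exact ⟨a + b, by simp [ha, hb, ha', hb', mul_add]⟩
  | smul a p _ hp =>
    obtain ⟨φ, hφ⟩ := hp
    refine ⟨algebraMap K L (MvPolynomial.constantCoeff a) • φ, fun M => ?_⟩
    obtain ⟨b, hb, hb'⟩ := hφ M
    exact ⟨lineEval M a * b, by
      simp [hb, hb', eval_zero_lineEval, mul_left_comm, Algebra.smul_def]⟩

theorem exists_linear_part_matrix {Y : Matrix (Fin 3) (Fin 3) (MvPolynomial (Fin 3 × Fin 3) K)}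
    (hY : MvPolynomial.constantCoeff.mapMatrix Y = 0) :
    ∃ f : Matrix (Fin 3) (Fin 3) L →ₗ[L] Matrix (Fin 3) (Fin 3) L,
      ∀ M, ∃ Q : Matrix (Fin 3) (Fin 3) L[X], (lineEval M).mapMatrix Y = (X : L[X]) • Q ∧
        (evalRingHom 0).mapMatrix Q = f M := by
  have h : ∀ i j, MvPolynomial.constantCoeff (Y i j) = 0 := fun i j => congr_fun₂ hY i j
  choose φ hφ using fun i j => exists_linear_part (L := L) (h i j)
  refine ⟨{ toFun := fun M => Matrix.of fun i j => φ i j M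
            map_add' := fun M N => by ext; simp
            map_smul' := fun c M => by ext; simp }, fun M => ?_⟩
  choose q hq using fun i j => hφ i j M
  exact ⟨Matrix.of q, by ext1 i j; simp [(hq i j).1], by ext1 i j; simp [(hq i j).2]⟩

variable {Y Z : Matrix (Fin 3) (Fin 3) (MvPolynomial (Fin 3 × Fin 3) K)}
  {u v : MvPolynomial (Fin 3 × Fin 3) K}

theorem lineEval_det_genericMatrix3 (M : Matrix (Fin 3) (Fin 3) L) :
    lineEval M (genericMatrix3 K).det = X ^ 3 * C M.det := by
  rw [AlgHom.map_det, lineEval_genericMatrix3, det_smul, Fintype.card_fin, RingHom.map_det]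

theorem eval_zero_mapMatrix_lineEval (M : Matrix (Fin 3) (Fin 3) L)
    (Y : Matrix (Fin 3) (Fin 3) (MvPolynomial (Fin 3 × Fin 3) K)) :
    (evalRingHom 0).mapMatrix ((lineEval M).mapMatrix Y) =
      (algebraMap K L).mapMatrix (MvPolynomial.constantCoeff.mapMatrix Y) := by
  ext i j
  simp [eval_zero_lineEval]

theorem Matrix.map_smul_ringHom {R S F : Type*} [CommRing R] [CommRing S] [FunLike F R S]
    [RingHomClass F R S] (φ : F) (c : R) (A : Matrix (Fin 3) (Fin 3) R) :
    (c • A).map φ = φ c • A.map φ := by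
  ext; simp

theorem constantCoeff_eq_zero_or (hinj : Function.Injective (algebraMap K L))
    (h : Z * genericMatrix3 K * Y = (genericMatrix3 K).det • 1) :
    MvPolynomial.constantCoeff.mapMatrix Z = 0 ∨ MvPolynomial.constantCoeff.mapMatrix Y = 0 := by
  by_contra! hne
  obtain ⟨a, i, hai⟩ : ∃ a i, MvPolynomial.constantCoeff (Z a i) ≠ 0 := by
    by_contra! h0
    exact hne.1 (by ext a i; exact h0 a i)
  obtain ⟨j, b, hjb⟩ : ∃ j b, MvPolynomial.constantCoeff (Y j b) ≠ 0 := by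
    by_contra! h0
    exact hne.2 (by ext j b; exact h0 j b)
  set M : Matrix (Fin 3) (Fin 3) L := Matrix.single i j 1 with hM
  have h1 := congr_arg (lineEval M).mapMatrix h
  rw [map_mul, map_mul, lineEval_genericMatrix3, AlgHom.mapMatrix_apply (M := _ • _),
    Matrix.map_smul_ringHom, lineEval_det_genericMatrix3, ← AlgHom.mapMatrix_apply, map_one,
    Matrix.mul_smul, Matrix.smul_mul, pow_succ', mul_assoc X, mul_smul] at h1
  have h2 := congr_arg (evalRingHom 0).mapMatrix (smul_right_injective _ X_ne_zero h1)
  have hCM : (evalRingHom 0).mapMatrix (C.mapMatrix M) = M := by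
    ext
    simp
  rw [map_mul, map_mul, eval_zero_mapMatrix_lineEval, eval_zero_mapMatrix_lineEval, hCM] at h2
  have h3 := congr_fun₂ h2 a b
  simp [hM, Matrix.mul_apply, Matrix.single_apply, ite_and, map_eq_zero_iff _ hinj, hai, hjb] at h3

theorem eval_zero_mapMatrix_eq_zero {c : L[X]} (hc : c.eval 0 ≠ 0)
    {B Q : Matrix (Fin 3) (Fin 3) L[X]} (h : c • (X : L[X]) • B = ((X : L[X]) • Q).adjugate) :
    (evalRingHom 0).mapMatrix B = 0 := by
  rw [adjugate_smul, smul_comm, Fintype.card_fin, Nat.add_one_sub_one, pow_two, mul_smul] at h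
  have h1 := congr_arg (evalRingHom 0).mapMatrix (smul_right_injective _ X_ne_zero h)
  rw [RingHom.mapMatrix_apply, Matrix.map_smul_ringHom,
    RingHom.mapMatrix_apply, Matrix.map_smul_ringHom] at h1
  simpa [hc] using h1

theorem false_of_proper_factorization (L : Type*) [Field L] [Infinite L] [Algebra K L]
    (hinj : Function.Injective (algebraMap K L)) (hY : Y.det = u * (genericMatrix3 K).det)
    (hZ : Z.det = v * (genericMatrix3 K).det) (hu : MvPolynomial.constantCoeff u ≠ 0)
    (hv : MvPolynomial.constantCoeff v ≠ 0)
    (hZXY : Z * genericMatrix3 K * Y = (genericMatrix3 K).det • 1)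
    (hadjY : u • (Z * genericMatrix3 K) = Y.adjugate)
    (hadjZ : v • (genericMatrix3 K * Y) = Z.adjugate) : False := by
  have hu' : ∀ M : Matrix (Fin 3) (Fin 3) L, (lineEval M u).eval 0 ≠ 0 := fun M => by
    rwa [eval_zero_lineEval, ne_eq, map_eq_zero_iff _ hinj]
  have hv' : ∀ M : Matrix (Fin 3) (Fin 3) L, (lineEval M v).eval 0 ≠ 0 := fun M => by
    rwa [eval_zero_lineEval, ne_eq, map_eq_zero_iff _ hinj]
  have eZ : ∀ M : Matrix (Fin 3) (Fin 3) L, lineEval M v • (X : L[X]) •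
      (C.mapMatrix M * (lineEval M).mapMatrix Y) = ((lineEval M).mapMatrix Z).adjugate := by
    intro M
    rw [← AlgHom.map_adjugate, ← hadjZ, AlgHom.mapMatrix_apply (M := _ • _),
      Matrix.map_smul_ringHom, ← AlgHom.mapMatrix_apply, map_mul, lineEval_genericMatrix3, Matrix.smul_mul]
  have eY : ∀ M : Matrix (Fin 3) (Fin 3) L, lineEval M u • (X : L[X]) •
      ((lineEval M).mapMatrix Z * C.mapMatrix M) = ((lineEval M).mapMatrix Y).adjugate := by
    intro M
    rw [← AlgHom.map_adjugate, ← hadjY, AlgHom.mapMatrix_apply (M := _ • _),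
      Matrix.map_smul_ringHom, ← AlgHom.mapMatrix_apply, map_mul, lineEval_genericMatrix3, Matrix.mul_smul]
  have hker : ∀ A : Matrix (Fin 3) (Fin 3) K, (algebraMap K L).mapMatrix A = 0 → A = 0 :=
    fun A hA => Matrix.map_injective hinj (hA.trans (map_zero (algebraMap K L).mapMatrix).symm)
  have h0 : MvPolynomial.constantCoeff.mapMatrix Y = 0 ∧
      MvPolynomial.constantCoeff.mapMatrix Z = 0 := by
    rcases constantCoeff_eq_zero_or hinj hZXY with h | h
    · refine ⟨hker _ ?_, h⟩
      obtain ⟨g, hg⟩ := exists_linear_part_matrix (L := L) h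
      obtain ⟨Q, hQ, -⟩ := hg 1
      have := eZ 1
      rw [hQ, map_one, one_mul] at this
      rw [← eval_zero_mapMatrix_lineEval 1]
      exact eval_zero_mapMatrix_eq_zero (hv' 1) this
    · refine ⟨h, hker _ ?_⟩
      obtain ⟨g, hg⟩ := exists_linear_part_matrix (L := L) h
      obtain ⟨Q, hQ, -⟩ := hg 1
      have := eY 1
      rw [hQ, map_one, mul_one] at this
      rw [← eval_zero_mapMatrix_lineEval 1]
      exact eval_zero_mapMatrix_eq_zero (hu' 1) this
  obtain ⟨f, hf⟩ := exists_linear_part_matrix (L := L) h0.1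
  obtain ⟨g, hg⟩ := exists_linear_part_matrix (L := L) h0.2
  have hdet : ∀ {W : Matrix (Fin 3) (Fin 3) (MvPolynomial (Fin 3 × Fin 3) K)}
      {w : MvPolynomial (Fin 3 × Fin 3) K}, W.det = w * (genericMatrix3 K).det →
      ∀ {M : Matrix (Fin 3) (Fin 3) L} {Q : Matrix (Fin 3) (Fin 3) L[X]},
      (lineEval M).mapMatrix W = (X : L[X]) • Q → ((evalRingHom 0).mapMatrix Q).det =
        algebraMap K L (MvPolynomial.constantCoeff w) * M.det := by
    intro W w hW M Q hQ
    have h := congr_arg (lineEval M) hW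
    rw [AlgHom.map_det, hQ, det_smul, Fintype.card_fin, map_mul, lineEval_det_genericMatrix3,
      mul_left_comm] at h
    have h1 := congr_arg (eval 0) (mul_left_cancel₀ (pow_ne_zero 3 X_ne_zero) h)
    rw [eval_mul, eval_zero_lineEval, eval_C] at h1
    rw [← h1, ← RingHom.map_det, coe_evalRingHom]
  refine false_of_linear_factorization (f := f) (g := g)
    (c := algebraMap K L (MvPolynomial.constantCoeff u))
    (d := algebraMap K L (MvPolynomial.constantCoeff v))
    (e := algebraMap K L (MvPolynomial.constantCoeff v))
    ((map_ne_zero_iff _ hinj).2 hu) ((map_ne_zero_iff _ hinj).2 hv) ((map_ne_zero_iff _ hinj).2 hv)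
    (fun M => ?_) (fun M => ?_) (fun M => ?_)
  · obtain ⟨Q, hQ, hQ'⟩ := hf M
    rw [← hQ', hdet hY hQ]
  · obtain ⟨Q, hQ, hQ'⟩ := hg M
    rw [← hQ', hdet hZ hQ]
  · obtain ⟨P, hP, hP'⟩ := hf M
    obtain ⟨Q, hQ, hQ'⟩ := hg M
    have h := eZ M
    rw [hP, hQ, adjugate_smul, Fintype.card_fin, Matrix.mul_smul, smul_smul X, ← pow_two,
      smul_comm] at h
    have h1 := congr_arg (evalRingHom 0).mapMatrix
      (smul_right_injective _ (pow_ne_zero 2 X_ne_zero) h)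
    rw [RingHom.mapMatrix_apply, Matrix.map_smul_ringHom, ← RingHom.mapMatrix_apply,
      map_mul, hP',
      RingHom.map_adjugate, hQ', coe_evalRingHom, eval_zero_lineEval] at h1
    rw [← h1]
    congr 2
    ext i j
    simp

end LineEval

/-- Let `K` be a unique factorization domain and `X` the generic `3 × 3`
matrix over `K`.  Then there are no nontrivial factorizations of `adj X`: whenever `Y`
and `Z` are `3 × 3` matrices over `S = K[x_{ij}]` with `adj X = Y * Z`, either `Y` is
invertible over `S` or `Z` is invertible over `S`. -/
theorem statement7 (K : Type*) [CommRing K] [IsDomain K] [UniqueFactorizationMonoid K]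
    (Y Z : Matrix (Fin 3) (Fin 3) (MvPolynomial (Fin 3 × Fin 3) K))
    (hfact : (genericMatrix3 K).adjugate = Y * Z) :
    IsUnit Y.det ∨ IsUnit Z.det := by
  set G := genericMatrix3 K with hG
  have hprime : Prime G.det := (irreducible_det_genericMatrix3 K).prime
  have hd : G.det ≠ 0 := hprime.ne_zero
  have hdet : Y.det * Z.det = G.det ^ 2 := by
    rw [← det_mul, ← hfact, det_adjugate, Fintype.card_fin]
  obtain ⟨i, hi, hYi⟩ := (dvd_prime_pow hprime 2).1 (Dvd.intro _ hdet)
  interval_cases i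
  · exact Or.inl (by simpa using hYi)
  · exfalso
    obtain ⟨w, hw⟩ := hYi.symm
    rw [pow_one] at hw
    have hY : Y.det = w * G.det := by rw [← hw, mul_comm]
    have hZ : Z.det = (w⁻¹ : (MvPolynomial (Fin 3 × Fin 3) K)ˣ) * G.det := by
      rw [hY, pow_two] at hdet
      refine mul_left_cancel₀ (mul_ne_zero w.ne_zero hd) ?_
      rw [hdet, mul_mul_mul_comm, Units.mul_inv, one_mul]
    have hcancel : ∀ {A B : Matrix (Fin 3) (Fin 3) (MvPolynomial (Fin 3 × Fin 3) K)},
        G.det • A = G.det • B → A = B := fun h => smul_right_injective _ hd h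
    have hXYZ : G * Y * Z = G.det • 1 := by rw [Matrix.mul_assoc, ← hfact, mul_adjugate]
    have hYZX : Y * Z * G = G.det • 1 := by rw [← hfact, adjugate_mul]
    have hadjY : (w : MvPolynomial (Fin 3 × Fin 3) K) • (Z * G) = Y.adjugate := by
      apply hcancel
      rw [smul_smul, mul_comm, ← hY, ← Matrix.mul_one Y.adjugate, ← Matrix.mul_smul Y.adjugate G.det,
        ← hYZX, ← Matrix.mul_assoc, ← Matrix.mul_assoc, adjugate_mul, Matrix.smul_mul,
        Matrix.smul_mul, Matrix.one_mul]
    have hadjZ : ((w⁻¹ : (MvPolynomial (Fin 3 × Fin 3) K)ˣ) : MvPolynomial (Fin 3 × Fin 3) K) •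
        (G * Y) = Z.adjugate := by
      apply hcancel
      rw [smul_smul, mul_comm, ← hZ, ← Matrix.one_mul Z.adjugate, ← Matrix.smul_mul G.det,
        ← hXYZ, Matrix.mul_assoc, mul_adjugate, Matrix.mul_smul, Matrix.mul_one]
    have hZXY : Z * G * Y = G.det • 1 := by
      refine smul_right_injective _ w.ne_zero ?_
      simp only
      rw [← Matrix.smul_mul, hadjY, adjugate_mul, hY, mul_smul]
    have hcc : ∀ w : (MvPolynomial (Fin 3 × Fin 3) K)ˣ,
        MvPolynomial.constantCoeff (w : MvPolynomial (Fin 3 × Fin 3) K) ≠ 0 :=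
      fun w => (w.isUnit.map MvPolynomial.constantCoeff).ne_zero
    have hinj : Function.Injective (algebraMap K (AlgebraicClosure (FractionRing K))) := by
      rw [IsScalarTower.algebraMap_eq K (FractionRing K), RingHom.coe_comp]
      exact (FaithfulSMul.algebraMap_injective (FractionRing K) _).comp (IsFractionRing.injective K _)
    exact false_of_proper_factorization (AlgebraicClosure (FractionRing K)) hinj hY hZ (hcc _) (hcc _)
      hZXY hadjY hadjZ
  · right
    obtain ⟨w, hw⟩ := hYi.symm
    rw [← hw, mul_assoc] at hdet
    exact IsUnit.of_mul_eq_one_right _ (mul_eq_left₀ (pow_ne_zero 2 hd) |>.1 hdet)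
end

section
/- Let K be a commutative Noetherian normal domain, n ≥ 2, X the generic n×n matrix over K with entries in S = K[x_{ij}], R = S/(det X), and L the cokernel of the R-linear map Rⁿ → Rⁿ given by the matrix X̄ (X reduced mod det X). Then the natural ring homomorphism R → End_R(L) sending r to multiplication by r is an isomorphism; in particular End_R(L) ≅ R. -/
open Matrix

noncomputable section

/-- The generic `n × n` matrix, whose `(i,j)` entry is the indeterminate `x_{ij}` of the
polynomial ring `S = K[x_{ij}]`. -/
def genericMatrix (K : Type*) [CommRing K] (n : ℕ) :
    Matrix (Fin n) (Fin n) (MvPolynomial (Fin n × Fin n) K) :=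
  Matrix.of fun i j => MvPolynomial.X (i, j)

/-- The generic determinantal hypersurface ring `R = S/(det X)`. -/
abbrev genericDetRing (K : Type*) [CommRing K] (n : ℕ) :=
  MvPolynomial (Fin n × Fin n) K ⧸ Ideal.span {(genericMatrix K n).det}

/-- The generic matrix reduced modulo its determinant. -/
def genericMatrixBar (K : Type*) [CommRing K] (n : ℕ) :
    Matrix (Fin n) (Fin n) (genericDetRing K n) :=
  (genericMatrix K n).map (Ideal.Quotient.mk _)

section MonomialOrder

open MvPolynomial MonomialOrder

variable {σ : Type*} {m : MonomialOrder σ} {K : Type*} [CommRing K]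

theorem monic_add_sum_of_degree_lt {ι : Type*} (f : ι → MvPolynomial σ K)
    (g : MvPolynomial σ K) (hg : m.Monic g) (s : Finset ι)
    (hs : ∀ i ∈ s, m.degree (f i) ≺[m] m.degree g) :
    m.Monic (g + ∑ i ∈ s, f i) ∧ m.degree (g + ∑ i ∈ s, f i) = m.degree g := by
  classical
  induction s using Finset.induction_on with
  | empty => simpa using hg
  | insert j s hj ih =>
    obtain ⟨h1, h2⟩ := ih fun i hi => hs i (Finset.mem_insert_of_mem hi)
    have hlt := hs j (Finset.mem_insert_self j s)
    rw [← h2] at hlt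
    rw [Finset.sum_insert hj, add_comm (f j), ← add_assoc]
    exact ⟨h1.add_of_lt hlt, (degree_add_of_lt hlt).trans h2⟩

theorem le_of_le_add_of_disjoint {a b c : σ →₀ ℕ} (hab : Disjoint a b) (h : a ≤ c + b) :
    a ≤ c := by
  intro i
  have h1 := DFunLike.congr_fun hab.eq_bot i
  have h2 := h i
  simp only [Finsupp.inf_apply, _root_.bot_eq_zero, Finsupp.coe_zero, Pi.zero_apply,
    Finsupp.add_apply] at h1 h2
  change min (a i) (b i) = 0 at h1
  change a i ≤ c i + b i at h2
  change a i ≤ c i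
  omega

variable [IsDomain K]

theorem dvd_of_dvd_mul_of_disjoint_degree {f g h : MvPolynomial σ K}
    (hf : IsUnit (m.leadingCoeff f)) (hg : g ≠ 0)
    (hfg : Disjoint (m.degree f) (m.degree g)) (hdvd : f ∣ g * h) : f ∣ h := by
  obtain ⟨q, r, hqr, -, hr⟩ := m.div_single hf h
  obtain ⟨k, hk⟩ : f ∣ r * g := by
    have : r * g = g * h - f * (q * g) := by rw [hqr]; ring
    rw [this]
    exact dvd_sub hdvd (dvd_mul_right _ _)
  rcases eq_or_ne r 0 with h0 | h0
  · exact ⟨q, by rw [hqr, h0]; ring⟩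
  refine absurd ?_ (hr _ (m.degree_mem_support h0))
  refine le_of_le_add_of_disjoint hfg ?_
  have hne : f * k ≠ 0 := hk ▸ mul_ne_zero h0 hg
  rw [← degree_mul h0 hg, hk, degree_mul' hne]
  exact le_self_add

theorem degree_le_of_mem_span_pair {f g p : MvPolynomial σ K}
    (hg : IsUnit (m.leadingCoeff g)) (hfg : Disjoint (m.degree g) (m.degree f))
    (hp : p ≠ 0) (u v : MvPolynomial σ K) (h : p = u * f + v * g) :
    m.degree f ≤ m.degree p ∨ m.degree g ≤ m.degree p := by
  obtain ⟨q, r, hqr, -, hr⟩ := m.div_single hg u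
  have h' : p = r * f + (v + q * f) * g := by rw [h, hqr]; ring
  generalize v + q * f = w at h'
  by_cases hrf : r * f = 0
  · right
    rw [hrf, zero_add] at h'
    rw [h', degree_mul' (h' ▸ hp)]
    exact le_add_self
  by_cases hwg : w * g = 0
  · left
    rw [hwg, add_zero] at h'
    rw [h', degree_mul' hrf]
    exact le_add_self
  have hne : m.degree (r * f) ≠ m.degree (w * g) := by
    intro e
    refine hr _ (m.degree_mem_support (left_ne_zero_of_mul hrf)) ?_
    refine le_of_le_add_of_disjoint hfg ?_
    rw [← degree_mul' hrf, e, degree_mul' hwg]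
    exact le_add_self
  have hmax := degree_add_of_ne hne
  rw [← h'] at hmax
  rcases max_choice (m.toSyn (m.degree (r * f))) (m.toSyn (m.degree (w * g))) with e | e
  · left
    rw [e] at hmax
    rw [m.toSyn.injective hmax, degree_mul' hrf]
    exact le_add_self
  · right
    rw [e] at hmax
    rw [m.toSyn.injective hmax, degree_mul' hwg]
    exact le_add_self

theorem exists_dvd_sub_mul_of_disjoint_degree {a b d : MvPolynomial σ K}
    (ha : IsUnit (m.leadingCoeff a)) (hd : IsUnit (m.leadingCoeff d)) (hb : b ≠ 0)
    (hda : Disjoint (m.degree d) (m.degree a)) (hab : Disjoint (m.degree a) (m.degree b))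
    (hdb : Disjoint (m.degree d) (m.degree b)) (s t : MvPolynomial σ K)
    (h : d ∣ s * b - t * a) : ∃ r, d ∣ s - r * a := by
  obtain ⟨q, r, hqr, -, hr⟩ := m.div (b := ![a, d])
    (by intro i; fin_cases i <;> assumption) s
  have hs : s = q 0 * a + q 1 * d + r := by
    rw [hqr, Finsupp.linearCombination_apply, Finsupp.sum_fintype _ _ (by simp)]
    simp
  refine ⟨q 0, q 1, ?_⟩
  suffices r = 0 by rw [hs, this]; ring
  by_contra h0
  obtain ⟨k, hk⟩ := h
  have hrb : r * b = (t - q 0 * b) * a + (k - q 1 * b) * d := by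
    have : r = s - q 0 * a - q 1 * d := by rw [hs]; ring
    rw [this]
    linear_combination hk
  have hne := mul_ne_zero h0 hb
  rcases degree_le_of_mem_span_pair hd hda hne _ _ hrb with e | e
  · rw [degree_mul' hne] at e
    exact hr _ (m.degree_mem_support h0) 0 (le_of_le_add_of_disjoint hab e)
  · rw [degree_mul' hne] at e
    exact hr _ (m.degree_mem_support h0) 1 (le_of_le_add_of_disjoint hdb e)

end MonomialOrder

section Adjugate

variable {ι S : Type*} [Fintype ι] [DecidableEq ι] [CommRing S] [IsDomain S]

theorem det_dvd_adjugate_minor_of_ne_zero (X : Matrix ι ι S) (p q j l : ι)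
    (h : X.adjugate p j ≠ 0) :
    X.det ∣ X.adjugate p j * X.adjugate q l - X.adjugate p l * X.adjugate q j := by
  set u : ι → S := X.adjugate *ᵥ Pi.single j 1 with hu
  set w : ι → S := X.adjugate *ᵥ Pi.single l 1 with hw
  have hu' : ∀ i, X.adjugate i j = u i := fun i => by simp [hu]
  have hw' : ∀ i, X.adjugate i l = w i := fun i => by simp [hw]
  simp only [hu', hw'] at h ⊢
  set Y := X.updateCol p (Pi.single j 1) with hY
  have hdet : Y.det = u p := by
    rw [hY, ← cramer_apply, cramer_eq_adjugate_mulVec]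
  have hXu : X *ᵥ u = X.det • Pi.single j 1 := by
    rw [hu, mulVec_mulVec, mul_adjugate, smul_mulVec, one_mulVec]
  have hXw : X *ᵥ w = X.det • Pi.single l 1 := by
    rw [hw, mulVec_mulVec, mul_adjugate, smul_mulVec, one_mulVec]
  set z : ι → S := u p • w - w p • u with hz
  have hYz : Y *ᵥ z = X *ᵥ z := by
    ext i
    refine Finset.sum_congr rfl fun k _ => ?_
    rcases eq_or_ne k p with rfl | hk
    · simp [hz, mul_comm]
    · simp [hY, updateCol_ne hk]
  have hYp : Y *ᵥ Pi.single p 1 = Pi.single j 1 := by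
    ext i
    simp [hY]
  have hj : Y.adjugate *ᵥ Pi.single j 1 = u p • Pi.single p 1 := by
    rw [← hYp, mulVec_mulVec, adjugate_mul, hdet, smul_mulVec, one_mulVec]
  have key : u p • z = X.det •
      (u p • (Y.adjugate *ᵥ Pi.single l 1) - w p • u p • Pi.single p 1) := by
    rw [← hj, ← hdet]
    conv_lhs => rw [← one_mulVec z, ← smul_mulVec, ← adjugate_mul, ← mulVec_mulVec, hYz, hz,
      mulVec_sub, mulVec_smul, mulVec_smul, hXu, hXw]
    simp only [mulVec_sub, mulVec_smul, smul_sub, hdet]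
    rw [smul_comm (u p), smul_comm (w p)]
  have keyq := congrFun key q
  simp only [hz, Pi.smul_apply, Pi.sub_apply, smul_eq_mul] at keyq
  refine ⟨(Y.adjugate *ᵥ Pi.single l 1) q - w p * (Pi.single p 1 : ι → S) q, ?_⟩
  apply mul_left_cancel₀ h
  linear_combination keyq

/-- The `2 × 2` minors of the adjugate are divisible by the determinant. -/
theorem det_dvd_adjugate_minor (X : Matrix ι ι S) (p q j l : ι) :
    X.det ∣ X.adjugate p j * X.adjugate q l - X.adjugate p l * X.adjugate q j := by
  by_cases h : X.adjugate p j = 0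
  · by_cases h' : X.adjugate p l = 0
    · simp [h, h']
    · rw [dvd_sub_comm]
      exact det_dvd_adjugate_minor_of_ne_zero X p q l j h'
  · exact det_dvd_adjugate_minor_of_ne_zero X p q j l h

theorem exists_eq_smul_one_add_mul (X : Matrix ι ι S) (hX : X.det ≠ 0) (p q p' q' : ι)
    (h₁ : ∀ r, X.det ∣ X.adjugate p q * r → X.det ∣ r)
    (h₂ : ∀ s t, X.det ∣ s * X.adjugate p' q' - t * X.adjugate p q →
      ∃ r, X.det ∣ s - r * X.adjugate p q)
    (A B : Matrix ι ι S) (hAB : A * X = X * B) :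
    ∃ (r : S) (C : Matrix ι ι S), A = r • 1 + X * C := by
  obtain ⟨M, hM⟩ : ∃ M, M = X.adjugate * A := ⟨_, rfl⟩
  have hM' : M = B * X.adjugate := by
    apply smul_right_injective _ hX
    calc X.det • M = X.adjugate * (A * X) * X.adjugate := by
          rw [Matrix.mul_assoc, Matrix.mul_assoc, mul_adjugate, hM]
          simp
      _ = X.det • (B * X.adjugate) := by
          rw [hAB, ← Matrix.mul_assoc, adjugate_mul]
          simp
  have cross : ∀ i j k l, X.det ∣ M i j * X.adjugate k l - M k l * X.adjugate i j := by
    intro i j k l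
    have e₁ : X.det ∣ M i j * X.adjugate k l - X.adjugate i l * M k j := by
      rw [hM, Matrix.mul_apply, Matrix.mul_apply, Finset.sum_mul, Finset.mul_sum,
        ← Finset.sum_sub_distrib]
      refine Finset.dvd_sum fun t _ => ?_
      convert (det_dvd_adjugate_minor X i k t l).mul_left (A t j) using 1
      ring
    have e₂ : X.det ∣ X.adjugate i l * M k j - M k l * X.adjugate i j := by
      rw [hM', Matrix.mul_apply, Matrix.mul_apply, Finset.sum_mul, Finset.mul_sum,
        ← Finset.sum_sub_distrib]
      refine Finset.dvd_sum fun t _ => ?_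
      convert (det_dvd_adjugate_minor X t i j l).mul_left (B k t) using 1
      ring
    convert dvd_add e₁ e₂ using 1
    ring
  obtain ⟨r, hr⟩ := h₂ _ _ (cross p q p' q')
  have hdvd : ∀ k l, X.det ∣ M k l - r * X.adjugate k l := by
    intro k l
    apply h₁
    convert dvd_sub (hr.mul_right (X.adjugate k l)) (cross p q k l) using 1
    ring
  choose C hC using hdvd
  refine ⟨r, of C, ?_⟩
  have hMC : M = r • X.adjugate + X.det • of C := by
    ext k l
    simp only [Matrix.add_apply, Matrix.smul_apply, of_apply, smul_eq_mul]
    linear_combination hC k l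
  apply smul_right_injective _ hX
  calc X.det • A = X * M := by rw [hM, ← Matrix.mul_assoc, mul_adjugate]; simp
    _ = X.det • (r • 1 + X * of C) := by
      rw [hMC, Matrix.mul_add, Matrix.mul_smul, mul_adjugate, Matrix.mul_smul, smul_add,
        smul_comm]

end Adjugate

section Cokernel

variable {ι S : Type*} [Fintype ι] [DecidableEq ι] [CommRing S]

theorem exists_eq_mul_of_mulVec_mem_range (X Y : Matrix ι ι S)
    (h : ∀ j, (Y.map (Ideal.Quotient.mk (Ideal.span {X.det}))).col j ∈
      LinearMap.range (mulVecLin (X.map (Ideal.Quotient.mk (Ideal.span {X.det}))))) :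
    ∃ C, Y = X * C := by
  choose v hv using h
  choose V hV using fun j i => Ideal.Quotient.mk_surjective (v j i)
  have hdvd : ∀ i j, X.det ∣ Y i j - (X * of fun i j => V j i) i j := by
    intro i j
    rw [← Ideal.mem_span_singleton, ← Ideal.Quotient.eq_zero_iff_mem, map_sub, sub_eq_zero]
    have := congrFun (hv j) i
    simp only [mulVecLin_apply, mulVec, dotProduct, col_apply, map_apply] at this
    rw [← this, Matrix.mul_apply, map_sum]
    simp [hV]
  choose D hD using hdvd
  refine ⟨(of fun i j => V j i) + X.adjugate * of D, ?_⟩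
  rw [Matrix.mul_add, ← Matrix.mul_assoc, mul_adjugate]
  ext i j
  simp only [Matrix.add_apply, smul_mul, Matrix.one_mul, Matrix.smul_apply, of_apply,
    smul_eq_mul]
  linear_combination hD i j

variable [IsDomain S]

theorem toModuleEnd_coker_bijective (X : Matrix ι ι S) (hX : X.det ≠ 0) (p q p' q' : ι)
    (h₁ : ∀ r, X.det ∣ X.adjugate p q * r → X.det ∣ r)
    (h₂ : ∀ s t, X.det ∣ s * X.adjugate p' q' - t * X.adjugate p q →
      ∃ r, X.det ∣ s - r * X.adjugate p q) :
    letI R := S ⧸ Ideal.span {X.det}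
    letI L := (ι → R) ⧸ LinearMap.range (mulVecLin (X.map (Ideal.Quotient.mk _)))
    Function.Bijective (Module.toModuleEnd R L : R →+* Module.End R L) := by
  set I := Ideal.span {X.det} with hI
  set N := LinearMap.range (mulVecLin (X.map (Ideal.Quotient.mk I)))
  have hsingle : ∀ i j, (Pi.single j 1 : ι → S ⧸ I) i =
      Ideal.Quotient.mk I ((1 : Matrix ι ι S) i j) := by
    intro i j
    simp [Matrix.one_apply, Pi.single_apply]
  constructor
  · rw [injective_iff_map_eq_zero]
    intro r hr
    obtain ⟨s, rfl⟩ := Ideal.Quotient.mk_surjective r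
    obtain ⟨C, hC⟩ := exists_eq_mul_of_mulVec_mem_range X (s • 1) fun j => by
      have h := LinearMap.congr_fun hr (N.mkQ (Pi.single j 1))
      rw [Module.toModuleEnd_apply, DistribSMul.toLinearMap_apply, ← map_smul,
        LinearMap.zero_apply, Submodule.mkQ_apply, Submodule.Quotient.mk_eq_zero] at h
      convert h using 1
      ext i
      rw [Pi.smul_apply, hsingle, smul_eq_mul, ← map_mul]
      rfl
    rw [Ideal.Quotient.eq_zero_iff_mem, hI, Ideal.mem_span_singleton]
    apply h₁
    have h := congrArg (fun Z => (X.adjugate * Z) p q) hC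
    simp only [← Matrix.mul_assoc, adjugate_mul, Matrix.mul_smul, Matrix.mul_one, Matrix.one_mul,
      Matrix.smul_apply, smul_mul, smul_eq_mul] at h
    exact ⟨C p q, by rw [mul_comm, h]⟩
  · intro φ
    choose v hv using fun j => N.mkQ_surjective (φ (N.mkQ (Pi.single j 1)))
    choose V hV using fun j i => Ideal.Quotient.mk_surjective (v j i)
    obtain ⟨A, hA⟩ : ∃ A : Matrix ι ι S, A = of fun i j => V j i := ⟨_, rfl⟩
    have hφ : φ ∘ₗ N.mkQ = N.mkQ ∘ₗ mulVecLin (A.map (Ideal.Quotient.mk I)) := by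
      refine LinearMap.pi_ext' fun j => LinearMap.ext_ring ?_
      simp only [LinearMap.comp_apply, LinearMap.single_apply, ← hv, mulVecLin_apply]
      congr 1
      ext i
      simp [hA, hV]
    obtain ⟨B, hB⟩ := exists_eq_mul_of_mulVec_mem_range X (A * X) fun j => by
      have h := LinearMap.congr_fun hφ (X.map (Ideal.Quotient.mk I) *ᵥ Pi.single j 1)
      have h0 : N.mkQ (X.map (Ideal.Quotient.mk I) *ᵥ Pi.single j 1) = 0 := by
        rw [Submodule.mkQ_apply, Submodule.Quotient.mk_eq_zero]
        exact ⟨_, rfl⟩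
      rw [LinearMap.comp_apply, h0, map_zero, LinearMap.comp_apply, eq_comm,
        Submodule.mkQ_apply, Submodule.Quotient.mk_eq_zero] at h
      convert h using 1
      rw [mulVecLin_apply, mulVec_mulVec, ← Matrix.map_mul, mulVec_single_one]
    obtain ⟨r, C, hrC⟩ := exists_eq_smul_one_add_mul X hX p q p' q' h₁ h₂ A B hB
    refine ⟨Ideal.Quotient.mk I r, ?_⟩
    refine Submodule.linearMap_qext _ ?_
    rw [hφ]
    ext1 j
    refine LinearMap.ext_ring ?_
    simp only [LinearMap.comp_apply, LinearMap.single_apply, Module.toModuleEnd_apply,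
      DistribSMul.toLinearMap_apply]
    rw [← map_smul, ← sub_eq_zero, ← map_sub, Submodule.mkQ_apply,
      Submodule.Quotient.mk_eq_zero]
    refine ⟨-((C.map (Ideal.Quotient.mk I)) *ᵥ Pi.single j 1), ?_⟩
    rw [mulVecLin_apply, mulVecLin_apply, mulVec_neg, mulVec_mulVec, ← Matrix.map_mul, hrC]
    rw [mulVec_single_one, mulVec_single_one]
    ext i
    simp only [hsingle, Pi.neg_apply, Pi.sub_apply, Pi.smul_apply, col_apply,
      map_apply, Matrix.add_apply, Matrix.smul_apply, smul_eq_mul, map_add, map_mul]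
    ring

end Cokernel

section GenericMinors

open MvPolynomial MonomialOrder

/-- The diagonal monomial of the minor with rows `r` and columns `c`. -/
def diagonalExponent {n k : ℕ} (r c : Fin k → Fin n) : Fin n × Fin n →₀ ℕ :=
  ∑ i, Finsupp.single (r i, c i) 1

theorem diagonalExponent_disjoint {n k l : ℕ} {r c : Fin k → Fin n} {r' c' : Fin l → Fin n}
    (h : ∀ i j, ¬ (r i = r' j ∧ c i = c' j)) :
    Disjoint (diagonalExponent r c) (diagonalExponent r' c') := by
  rw [disjoint_iff]
  ext ⟨x, y⟩
  simp only [Finsupp.inf_apply, diagonalExponent, Finsupp.coe_finsetSum, Finset.sum_apply,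
    _root_.bot_eq_zero, Finsupp.coe_zero, Pi.zero_apply]
  by_cases hx : ∃ i, r i = x ∧ c i = y
  · obtain ⟨i, rfl, rfl⟩ := hx
    have : ∑ j, (Finsupp.single (r' j, c' j) 1 : Fin n × Fin n →₀ ℕ) (r i, c i) = 0 := by
      refine Finset.sum_eq_zero fun j _ => Finsupp.single_eq_of_ne fun e => h i j ?_
      simpa using e
    rw [this]
    simp
  · have : ∑ j, (Finsupp.single (r j, c j) 1 : Fin n × Fin n →₀ ℕ) (x, y) = 0 := by
      refine Finset.sum_eq_zero fun j _ => Finsupp.single_eq_of_ne fun e => hx ⟨j, ?_⟩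
      simpa [eq_comm] using e
    rw [this]
    simp

/-- The lexicographic term order for which `x_{ij} > x_{kl}` when `(i, j)` precedes `(k, l)`
lexicographically. -/
def diagonalOrder (n : ℕ) : MonomialOrder (Fin n × Fin n) :=
  let o : LinearOrder (Fin n × Fin n) :=
    LinearOrder.lift' (toLex : Fin n × Fin n → Fin n ×ₗ Fin n) toLex.injective
  @MonomialOrder.lex _ o (@Finite.to_wellFoundedGT _ _ o.toPreorder)

theorem diagonalOrder_lt {n : ℕ} {a b : Fin n × Fin n →₀ ℕ} (i j : Fin n)
    (h : ∀ x y, x < i ∨ x = i ∧ y < j → a (x, y) = b (x, y)) (hij : a (i, j) < b (i, j)) :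
    a ≺[diagonalOrder n] b := by
  let o : LinearOrder (Fin n × Fin n) :=
    LinearOrder.lift' (toLex : Fin n × Fin n → Fin n ×ₗ Fin n) toLex.injective
  exact (@Finsupp.Lex.lt_iff _ ℕ _ o.toLT _ _ _).mpr ⟨(i, j), fun w hw => h w.1 w.2 (Prod.Lex.toLex_lt_toLex.mp hw), hij⟩

theorem diagonalExponent_comp_perm_lt {n k : ℕ} {r c : Fin k → Fin n} (hr : StrictMono r)
    (hc : StrictMono c) {τ : Equiv.Perm (Fin k)} (hτ : τ ≠ 1) :
    diagonalExponent r (c ∘ τ) ≺[diagonalOrder n] diagonalExponent r c := by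
  classical
  have hex : ∃ i, τ i ≠ i := by
    by_contra! h
    exact hτ (Equiv.ext h)
  obtain ⟨i, hi, hmin⟩ := WellFounded.has_min (wellFounded_lt (α := Fin k)) {i | τ i ≠ i} hex
  have hfix : ∀ j, j < i → τ j = j := fun j hj => by
    by_contra h
    exact hmin j h hj
  have hlt : i < τ i := by
    rcases lt_trichotomy (τ i) i with h | h | h
    · exact absurd (τ.injective (hfix _ h)) hi
    · exact absurd h hi
    · exact h
  refine diagonalOrder_lt (r i) (c i) ?_ ?_
  · intro x y hxy
    simp only [diagonalExponent, Finsupp.coe_finsetSum, Finset.sum_apply, Function.comp]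
    refine Finset.sum_congr rfl fun j _ => ?_
    by_cases hj : j < i
    · rw [hfix j hj]
    have hrj : r i ≤ r j := hr.monotone (not_lt.mp hj)
    have hne : ∀ l, i ≤ l ∨ j ≠ i → (r j, c l) ≠ (x, y) := by
      intro l hl e
      obtain ⟨rfl, rfl⟩ := Prod.mk.inj e
      rcases hxy with h | ⟨h, h'⟩
      · exact absurd h (not_lt.mpr hrj)
      · rcases hl with hl | hl
        · exact absurd (hc.lt_iff_lt.mp h') (not_lt.mpr hl)
        · exact hl (hr.injective h)
    rw [Finsupp.single_eq_of_ne' (hne _ ?_), Finsupp.single_eq_of_ne' (hne _ ?_)]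
    · exact Or.inl (not_lt.mp hj)
    · by_cases e : j = i
      · exact Or.inl (e ▸ hlt.le)
      · exact Or.inr e
  · simp only [diagonalExponent, Finsupp.coe_finsetSum, Finset.sum_apply, Function.comp]
    rw [Finset.sum_eq_zero fun j _ => ?_]
    · refine Finset.sum_pos' (fun _ _ => Nat.zero_le _) ⟨i, Finset.mem_univ i, ?_⟩
      simp
    · refine Finsupp.single_eq_of_ne' fun e => ?_
      obtain ⟨h, h'⟩ := Prod.mk.inj e
      obtain rfl := hr.injective h
      exact hi (hc.injective h')

variable {K : Type*} [CommRing K] [IsDomain K]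

/-- The leading term of every minor of the generic matrix is its diagonal term. -/
theorem monic_minor_and_degree_minor {n k : ℕ} {r c : Fin k → Fin n} (hr : StrictMono r)
    (hc : StrictMono c) :
    (diagonalOrder n).Monic ((genericMatrix K n).submatrix r c).det ∧
      (diagonalOrder n).degree ((genericMatrix K n).submatrix r c).det =
        diagonalExponent r c := by
  classical
  have hprod : ∀ τ : Equiv.Perm (Fin k),
      ∏ i, ((genericMatrix K n).submatrix r c)ᵀ (τ i) i =
        monomial (diagonalExponent r (c ∘ τ)) (1 : K) := by
    intro τ
    rw [diagonalExponent, monomial_sum_one]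
    rfl
  have hdeg : ∀ τ : Equiv.Perm (Fin k), (diagonalOrder n).degree
      (monomial (diagonalExponent r (c ∘ τ)) (1 : K)) = diagonalExponent r (c ∘ τ) := by
    intro τ
    rw [degree_monomial, if_neg one_ne_zero]
  rw [← det_transpose, det_apply, ← Finset.add_sum_erase _ _ (Finset.mem_univ 1)]
  simp only [hprod, Equiv.Perm.sign_one, one_smul]
  have h1 := hdeg 1
  rw [Equiv.Perm.coe_one, Function.comp_id] at h1 ⊢
  suffices h : ∀ τ ∈ Finset.univ.erase 1, (diagonalOrder n).degree (Equiv.Perm.sign τ •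
      monomial (diagonalExponent r (c ∘ τ)) (1 : K)) ≺[diagonalOrder n]
        (diagonalOrder n).degree (monomial (diagonalExponent r c) (1 : K)) by
    have := monic_add_sum_of_degree_lt _ _ monic_monomial_one _ h
    exact ⟨this.1, this.2.trans h1⟩
  intro τ hτ
  rw [h1]
  refine lt_of_eq_of_lt ?_ (diagonalExponent_comp_perm_lt hr hc (Finset.ne_of_mem_erase hτ))
  congr 1
  rcases Int.units_eq_one_or (Equiv.Perm.sign τ) with e | e
  · rw [e, one_smul, hdeg]
  · rw [e, Units.neg_smul, one_smul, degree_neg, hdeg]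

theorem isUnit_leadingCoeff_adjugate_and_degree {n : ℕ} (i j : Fin (n + 1)) :
    IsUnit ((diagonalOrder (n + 1)).leadingCoeff ((genericMatrix K (n + 1)).adjugate i j)) ∧
      (diagonalOrder (n + 1)).degree ((genericMatrix K (n + 1)).adjugate i j) =
        diagonalExponent j.succAbove i.succAbove := by
  obtain ⟨h, h'⟩ := monic_minor_and_degree_minor (K := K) (Fin.strictMono_succAbove j)
    (Fin.strictMono_succAbove i)
  rw [adjugate_fin_succ_eq_det_submatrix]
  rcases neg_one_pow_eq_or (MvPolynomial (Fin (n + 1) × Fin (n + 1)) K) (j + i : ℕ) with e | e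
  · rw [e, one_mul]
    exact ⟨h.leadingCoeff_eq_one ▸ isUnit_one, h'⟩
  · rw [e, neg_one_mul, leadingCoeff_neg, degree_neg, h.leadingCoeff_eq_one]
    exact ⟨isUnit_one.neg, h'⟩

end GenericMinors

set_option synthInstance.maxHeartbeats 1000000 in
/-- Let `K` be a commutative Noetherian normal domain, `n ≥ 2`, `X` the
generic `n × n` matrix over `K`, `R = S/(det X)`, and `L = coker(X̄ : Rⁿ → Rⁿ)`.  Then the
natural ring homomorphism `R → End_R(L)` sending `r` to multiplication by `r` is an
isomorphism. -/
theorem statement12 (K : Type*) [CommRing K] [IsDomain K] [IsNoetherianRing K]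
    [IsIntegrallyClosed K] (n : ℕ) (hn : 2 ≤ n) :
    letI R := genericDetRing K n
    letI L := (Fin n → R) ⧸ LinearMap.range (Matrix.mulVecLin (genericMatrixBar K n))
    Function.Bijective (Module.toModuleEnd R L : R →+* Module.End R L) := by
  obtain ⟨n, rfl⟩ := Nat.exists_eq_add_of_le' (one_le_two.trans hn)
  obtain ⟨hd, hd'⟩ := monic_minor_and_degree_minor (K := K) (n := n + 1) strictMono_id
    strictMono_id
  rw [submatrix_id_id] at hd hd'
  have hdu : IsUnit ((diagonalOrder (n + 1)).leadingCoeff (genericMatrix K (n + 1)).det) :=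
    hd.leadingCoeff_eq_one ▸ isUnit_one
  obtain ⟨ha, ha'⟩ := isUnit_leadingCoeff_adjugate_and_degree (K := K) (Fin.last n) 0
  obtain ⟨hb, hb'⟩ := isUnit_leadingCoeff_adjugate_and_degree (K := K) 0 (Fin.last n)
  have ha0 := MonomialOrder.leadingCoeff_ne_zero_iff.mp ha.ne_zero
  have hb0 := MonomialOrder.leadingCoeff_ne_zero_iff.mp hb.ne_zero
  rw [Fin.succAbove_zero, Fin.succAbove_last] at ha' hb'
  have hda : Disjoint (diagonalExponent (id : Fin (n + 1) → Fin (n + 1)) id)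
      (diagonalExponent (Fin.succ : Fin n → Fin (n + 1)) Fin.castSucc) :=
    diagonalExponent_disjoint fun i j h => by
      simp only [id, Fin.ext_iff, Fin.val_succ, Fin.val_castSucc] at h
      omega
  have hdb : Disjoint (diagonalExponent (id : Fin (n + 1) → Fin (n + 1)) id)
      (diagonalExponent (Fin.castSucc : Fin n → Fin (n + 1)) Fin.succ) :=
    diagonalExponent_disjoint fun i j h => by
      simp only [id, Fin.ext_iff, Fin.val_succ, Fin.val_castSucc] at h
      omega
  have hab : Disjoint (diagonalExponent (Fin.succ : Fin n → Fin (n + 1)) Fin.castSucc)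
      (diagonalExponent (Fin.castSucc : Fin n → Fin (n + 1)) Fin.succ) :=
    diagonalExponent_disjoint fun i j h => by
      simp only [Fin.ext_iff, Fin.val_succ, Fin.val_castSucc] at h
      omega
  rw [← hd', ← ha'] at hda
  rw [← hd', ← hb'] at hdb
  rw [← ha', ← hb'] at hab
  exact toModuleEnd_coker_bijective (genericMatrix K (n + 1)) hd.ne_zero _ _ _ _
    (fun _ h => dvd_of_dvd_mul_of_disjoint_degree hdu ha0 hda h)
    (fun s t h => exists_dvd_sub_mul_of_disjoint_degree ha hdu hb0 hda hab hdb s t h)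

end
end

section
/- Let K be a commutative Noetherian normal domain, n ≥ 2, X the generic n×n matrix over K with entries in S = K[x_{ij}], R = S/(det X), and L the cokernel of the R-linear map Rⁿ → Rⁿ given by the matrix X̄ (X reduced mod det X). Then Ext¹_R(L, L) = 0; that is, the R-module L is rigid. -/
open Matrix CategoryTheory

noncomputable section

namespace Matrix

variable {n S : Type*} [Fintype n] [DecidableEq n] [CommRing S]

theorem adjugate_apply_eq_det_updateCol (X : Matrix n n S) (i j : n) :
    X.adjugate i j = (X.updateCol i (Pi.single j 1)).det := by
  rw [← cramer_apply, cramer_eq_adjugate_mulVec]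
  simp

/-- In the cokernel of `X`, the basis vectors satisfy `adj(X)ⱼᵢ eₖ = adj(X)ⱼₖ eᵢ`. -/
theorem exists_mulVec_eq_adjugate_smul_sub (X : Matrix n n S) (i j k : n) :
    ∃ w : n → S, X *ᵥ w =
      X.adjugate j i • Pi.single k (1 : S) - X.adjugate j k • Pi.single i (1 : S) := by
  set Z := X.updateCol j (Pi.single k 1) with hZ
  have hj : Z.adjugate j i = X.adjugate j i := by
    rw [adjugate_apply_eq_det_updateCol, adjugate_apply_eq_det_updateCol, hZ, updateCol_idem]
  have hd : Z.det = X.adjugate j k := (adjugate_apply_eq_det_updateCol X j k).symm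
  refine ⟨-Function.update (fun c => Z.adjugate c i) j 0, ?_⟩
  ext r
  have h := congrFun (congrFun (mul_adjugate Z) r) i
  rw [mul_apply, ← Finset.add_sum_erase _ _ (Finset.mem_univ j), hj, hd] at h
  have h' : (X *ᵥ Function.update (fun c => Z.adjugate c i) j 0) r =
      ∑ c ∈ Finset.univ.erase j, Z r c * Z.adjugate c i := by
    rw [mulVec, dotProduct, ← Finset.add_sum_erase _ _ (Finset.mem_univ j)]
    simp only [Function.update_self, mul_zero, zero_add]
    refine Finset.sum_congr rfl fun c hc => ?_
    have hc : c ≠ j := Finset.ne_of_mem_erase hc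
    simp [hZ, hc]
  rw [mulVec_neg, Pi.neg_apply, h']
  simp only [hZ, updateCol_self, smul_apply, smul_eq_mul, Pi.sub_apply, Pi.smul_apply,
    one_apply, Pi.single_apply] at h ⊢
  linear_combination -h

theorem exists_mul_eq_adjugate_smul_sub (X : Matrix n n S) (i j k : n) (b : n → S) :
    ∃ W : Matrix n n S, X * W = X.adjugate j i • vecMulVec (Pi.single k (1 : S)) b -
      X.adjugate j k • vecMulVec (Pi.single i (1 : S)) b := by
  obtain ⟨w, hw⟩ := exists_mulVec_eq_adjugate_smul_sub X i j k
  refine ⟨vecMulVec w b, ?_⟩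
  rw [mul_vecMulVec, hw, sub_vecMulVec, smul_vecMulVec, smul_vecMulVec]

theorem exists_mul_eq_adjugate_smul_sub' (X : Matrix n n S) (j k l : n) (b : n → S) :
    ∃ W : Matrix n n S, W * X = X.adjugate j k • vecMulVec b (Pi.single l (1 : S)) -
      X.adjugate l k • vecMulVec b (Pi.single j (1 : S)) := by
  obtain ⟨W, hW⟩ := exists_mul_eq_adjugate_smul_sub Xᵀ j k l b
  refine ⟨Wᵀ, ?_⟩
  have := congrArg transpose hW
  rw [transpose_mul, transpose_transpose] at this
  simpa [← adjugate_transpose] using this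

/-- Every matrix `A` with `tr (A adj X) = 0` has the form `C X + X D`. -/
def TraceLift (X : Matrix n n S) : Prop :=
  ∀ A : Matrix n n S, (A * X.adjugate).trace = 0 → ∃ C D, A = C * X + X * D

/-- Every endomorphism of the cokernel of `X` (presented by a pair `C X = X D`) is a scalar. -/
def ScalarEnd (X : Matrix n n S) : Prop :=
  ∀ C D : Matrix n n S, C * X = X * D → ∃ (s : S) (E : Matrix n n S), C = s • 1 + X * E

/-- Every scalar annihilating the cokernel of `X` is a multiple of `det X`. -/
def AnnihilatorEqDet (X : Matrix n n S) : Prop :=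
  ∀ (s : S) (E : Matrix n n S), s • 1 = X * E → X.det ∣ s

theorem exists_adjugate_smul_eq_of_trace_eq_zero (X A : Matrix n n S) (i j : n)
    (hA : (A * X.adjugate).trace = 0) :
    ∃ C D, X.adjugate j i • A = C * X + X * D := by
  choose U hU using fun k l => exists_mul_eq_adjugate_smul_sub X i j k (Pi.single l (1 : S))
  choose V hV using fun k l => exists_mul_eq_adjugate_smul_sub' X j k l (Pi.single i (1 : S))
  refine ⟨∑ k, ∑ l, A k l • V k l, ∑ k, ∑ l, A k l • U k l, ?_⟩
  have hA' : ∑ k, ∑ l, A k l * X.adjugate l k = 0 := by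
    simpa [trace, mul_apply] using hA
  have hs : A = ∑ k, ∑ l, A k l • vecMulVec (Pi.single k (1 : S)) (Pi.single l (1 : S)) := by
    ext r c
    simp [Matrix.sum_apply, vecMulVec_apply, Pi.single_apply]
  have key : ∀ k l, A k l • (V k l * X) + A k l • (X * U k l) =
      X.adjugate j i • A k l • vecMulVec (Pi.single k (1 : S)) (Pi.single l (1 : S)) -
      (A k l * X.adjugate l k) •
        vecMulVec (Pi.single i (1 : S)) (Pi.single j (1 : S)) := by
    intro k l
    rw [hU, hV]
    module
  simp only [Finset.sum_mul, Finset.mul_sum, smul_mul_assoc, mul_smul_comm,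
    ← Finset.sum_add_distrib, key, Finset.sum_sub_distrib]
  simp only [← Finset.sum_smul, ← Finset.smul_sum, hA', ← hs]
  simp

theorem exists_adjugate_smul_eq_of_mul_eq_mul (X C D : Matrix n n S) (i j : n)
    (h : C * X = X * D) :
    ∃ (s : S) (E : Matrix n n S), X.adjugate j i ^ 2 • C = s • 1 + X * E := by
  choose w hw using exists_mulVec_eq_adjugate_smul_sub X i j
  set δ := X.adjugate j i
  set P : Matrix n n S := vecMulVec (Pi.single i 1) (X.adjugate j)
  set W : Matrix n n S := of fun r k => w k r
  have hW : δ • (1 : Matrix n n S) = X * W + P := by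
    ext r k
    have := congrFun (hw k) r
    simp only [mulVec, dotProduct, Pi.sub_apply, Pi.smul_apply, smul_eq_mul] at this
    simp only [smul_apply, add_apply, mul_apply, W, P, of_apply, vecMulVec_apply, smul_eq_mul,
      this, one_apply, Pi.single_apply]
    ring
  set s := X.adjugate j ⬝ᵥ C *ᵥ Pi.single i 1
  have hP : P * (C * P) = s • P := by
    simp only [P, mul_vecMulVec, vecMulVec_mulVec, s, op_smul_eq_smul, smul_vecMulVec]
  refine ⟨s * δ, δ • (D * W) + W * (C * P) - s • W, ?_⟩
  calc δ ^ 2 • C = δ • (C * (δ • 1)) := by simp [pow_two, mul_smul]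
    _ = δ • (C * X * W) + (δ • 1) * (C * P) := by
      rw [hW, mul_add, smul_add, ← hW, smul_mul_assoc, one_mul, Matrix.mul_assoc]
    _ = δ • (X * D * W) + (X * W * (C * P) + s • P) := by rw [h, hW, add_mul, hP]
    _ = _ := by
      have : s • P = (s * δ) • 1 - s • (X * W) := by rw [mul_smul, hW]; module
      rw [this]
      simp only [mul_add, mul_sub, mul_smul_comm, Matrix.mul_assoc]
      abel

section Cancellation

variable {n S : Type*} [Fintype n] [DecidableEq n] [CommRing S] {f : S} {ρ : S →+* S}

theorem exists_eq_mapMatrix_add_smul (hρ : ∀ a, f ∣ a - ρ a) (M : Matrix n n S) :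
    ∃ M', M = ρ.mapMatrix M + f • M' := by
  choose g hg using fun i j => hρ (M i j)
  refine ⟨of g, ?_⟩
  ext i j
  simpa [sub_eq_iff_eq_add, add_comm] using hg i j

theorem mapMatrix_smul_self (hρf : ρ f = 0) (M : Matrix n n S) : ρ.mapMatrix (f • M) = 0 := by
  ext i j
  simp [hρf]

theorem mapMatrix_smul_one (s : S) :
    ρ.mapMatrix (s • (1 : Matrix n n S)) = ρ s • (1 : Matrix n n S) := by
  ext i j
  by_cases h : i = j <;> simp [h]

theorem eq_zero_of_mul_eq_zero_of_det_ne_zero [IsDomain S] {X M : Matrix n n S} (hX : X.det ≠ 0)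
    (h : X * M = 0) : M = 0 := by
  have := congrArg (X.adjugate * ·) h
  simp only [← Matrix.mul_assoc, adjugate_mul, mul_zero, smul_mul_assoc, one_mul] at this
  exact (smul_eq_zero.mp this).resolve_left hX

theorem scalarEnd_of_pow [IsDomain S] (hf : f ≠ 0) (hρf : ρ f = 0) (hρ : ∀ a, f ∣ a - ρ a)
    {X : Matrix n n S} (hdet : (ρ.mapMatrix X).det ≠ 0) (hX : AnnihilatorEqDet (ρ.mapMatrix X))
    (i j : n) (N : ℕ) (hN : X.adjugate j i ^ 2 = f ^ N) : ScalarEnd X := by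
  have cancel : ∀ (C : Matrix n n S), (∃ (s : S) (E : Matrix n n S), f • C = s • 1 + X * E) →
      ∃ (s : S) (E : Matrix n n S), C = s • 1 + X * E := by
    rintro C ⟨s, E, h⟩
    have h0 := congrArg ρ.mapMatrix h
    rw [mapMatrix_smul_self hρf, map_add, map_mul, mapMatrix_smul_one] at h0
    obtain ⟨u, hu⟩ := hX (ρ s) (-ρ.mapMatrix E) (by
      rw [mul_neg]; exact eq_neg_of_add_eq_zero_left h0.symm)
    obtain ⟨s', hs'⟩ : ∃ s', s = X.det * u + f * s' := by
      obtain ⟨a, ha⟩ := hρ s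
      obtain ⟨b, hb⟩ := hρ X.det
      rw [RingHom.map_det] at hb
      exact ⟨a - b * u, by linear_combination ha + hu - u * hb⟩
    have h1 : f • C = (f * s') • 1 + X * (E + u • X.adjugate) := by
      rw [h, hs', mul_add, mul_smul_comm, mul_adjugate]
      module
    have h2 := congrArg ρ.mapMatrix h1
    rw [mapMatrix_smul_self hρf, map_add, map_mul, mul_smul f, mapMatrix_smul_self hρf,
      zero_add] at h2
    have h3 := eq_zero_of_mul_eq_zero_of_det_ne_zero hdet h2.symm
    obtain ⟨E', hE'⟩ := exists_eq_mapMatrix_add_smul hρ (E + u • X.adjugate)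
    rw [h3, zero_add] at hE'
    refine ⟨s', E', (smul_right_inj hf).mp ?_⟩
    rw [h1, hE', smul_add, mul_smul, mul_smul_comm]
  intro C D h
  obtain ⟨s, E, hs⟩ := exists_adjugate_smul_eq_of_mul_eq_mul X C D i j h
  rw [hN] at hs
  clear hN
  induction N generalizing s E with
  | zero => exact ⟨s, E, by simpa using hs⟩
  | succ N ih =>
    rw [pow_succ', mul_smul] at hs
    obtain ⟨s, E, h⟩ := cancel _ ⟨s, E, hs⟩
    exact ih s E h

theorem traceLift_of_pow [IsDomain S] (hf : f ≠ 0) (hρf : ρ f = 0) (hρ : ∀ a, f ∣ a - ρ a)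
    {X : Matrix n n S} (hdet : (ρ.mapMatrix X).det ≠ 0) (hX : ScalarEnd (ρ.mapMatrix X))
    (i j : n) (N : ℕ) (hN : X.adjugate j i ^ 2 = f ^ N) : TraceLift X := by
  have cancel : ∀ (A : Matrix n n S), (∃ C D : Matrix n n S, f • A = C * X + X * D) →
      ∃ C D : Matrix n n S, A = C * X + X * D := by
    rintro A ⟨C, D, h⟩
    have h0 := congrArg ρ.mapMatrix h
    rw [mapMatrix_smul_self hρf, map_add, map_mul, map_mul] at h0
    obtain ⟨s, E, hs⟩ := hX _ (-ρ.mapMatrix D) (by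
      rw [mul_neg]; exact eq_neg_of_add_eq_zero_left h0.symm)
    obtain ⟨X', hX'⟩ := exists_eq_mapMatrix_add_smul hρ X
    obtain ⟨C', hC'⟩ := exists_eq_mapMatrix_add_smul hρ C
    obtain ⟨D', hD'⟩ := exists_eq_mapMatrix_add_smul hρ D
    set Y := ρ.mapMatrix X
    have hD : ρ.mapMatrix D = -(s • 1 + E * Y) := by
      rw [← sub_eq_zero]
      refine eq_zero_of_mul_eq_zero_of_det_ne_zero hdet ?_
      rw [h0, hs]
      simp only [mul_sub, mul_neg, mul_add, add_mul, smul_mul_assoc, mul_smul_comm, one_mul,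
        mul_one, Matrix.mul_assoc]
      abel
    have hXY : Y = X - f • X' := by rw [eq_sub_iff_add_eq, ← hX']
    refine ⟨C' - X' * E, D' + E * X', (smul_right_inj hf).mp ?_⟩
    rw [h, hC', hD', hs, hD, hXY]
    simp only [mul_sub, sub_mul, mul_neg, mul_add, add_mul, smul_mul_assoc, mul_smul_comm,
      one_mul, mul_one, Matrix.mul_assoc, smul_add, smul_sub]
    abel
  intro A hA
  obtain ⟨C, D, h⟩ := exists_adjugate_smul_eq_of_trace_eq_zero X A i j hA
  have h : f ^ N • A = (X.adjugate j i • C) * X + X * (X.adjugate j i • D) := by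
    rw [← hN, pow_two, mul_smul, h, smul_add, smul_mul_assoc, mul_smul_comm]
  clear hN
  generalize X.adjugate j i • C = C, X.adjugate j i • D = D at h
  induction N generalizing C D with
  | zero => exact ⟨C, D, by simpa using h⟩
  | succ N ih =>
    rw [pow_succ', mul_smul] at h
    obtain ⟨C, D, h⟩ := cancel _ ⟨C, D, h⟩
    exact ih C D h

theorem annihilatorEqDet_diagonal [IsDomain S] (v : n → S) (hv : ∀ i, Prime (v i))
    (hne : ∀ i j, i ≠ j → ¬ v i ∣ v j) : AnnihilatorEqDet (diagonal v) := by
  intro s E h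
  rw [det_diagonal]
  have hd : ∀ i, v i ∣ s := fun i => ⟨E i i, by simpa using congrFun (congrFun h i) i⟩
  suffices ∀ t : Finset n, ∏ i ∈ t, v i ∣ s from this _
  intro t
  induction t using Finset.induction_on with
  | empty => simp
  | insert i t hi ih =>
    rw [Finset.prod_insert hi]
    obtain ⟨u, rfl⟩ := ih
    rw [mul_comm]
    refine mul_dvd_mul_left _ (((hv i).dvd_or_dvd (hd i)).resolve_left fun h => ?_)
    obtain ⟨j, hj, hij⟩ := (Prime.dvd_finsetProd_iff (hv i) _).mp h
    exact hne i j (by rintro rfl; exact hi hj) hij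

end Cancellation

section Degeneration

open Polynomial

variable {S : Type*} [CommRing S]

theorem submatrix_X_smul_add {n m : Type*} (X₀ X₁ : Matrix n n S) (r c : m → n) :
    ((X : S[X]) • X₀.map C + X₁.map C).submatrix r c =
      (X : S[X]) • (X₀.submatrix r c).map C + (X₁.submatrix r c).map C :=
  rfl

theorem natDegree_adjugate_X_smul_add_le {m : ℕ} (X₀ X₁ : Matrix (Fin (m + 1)) (Fin (m + 1)) S)
    (i j : Fin (m + 1)) :
    (((X : S[X]) • X₀.map C + X₁.map C).adjugate i j).natDegree ≤ m := by
  rw [adjugate_fin_succ_eq_det_submatrix, submatrix_X_smul_add]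
  refine natDegree_mul_le.trans ?_
  have h := natDegree_det_X_add_C_le (X₀.submatrix j.succAbove i.succAbove)
    (X₁.submatrix j.succAbove i.succAbove)
  have h' : ((-1 : S[X]) ^ (j + i : ℕ)).natDegree = 0 := by
    rcases neg_one_pow_eq_or S[X] (j + i : ℕ) with h | h <;> simp [h]
  simpa [h'] using h

theorem coeff_adjugate_X_smul_add {m : ℕ} (X₀ X₁ : Matrix (Fin (m + 1)) (Fin (m + 1)) S)
    (i j : Fin (m + 1)) :
    (((X : S[X]) • X₀.map C + X₁.map C).adjugate i j).coeff m = X₀.adjugate i j := by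
  rw [adjugate_fin_succ_eq_det_submatrix, submatrix_X_smul_add,
    adjugate_fin_succ_eq_det_submatrix]
  have h := coeff_det_X_add_C_card (X₀.submatrix j.succAbove i.succAbove)
    (X₁.submatrix j.succAbove i.succAbove)
  rw [Fintype.card_fin] at h
  rw [show (-1 : S[X]) ^ (j + i : ℕ) = C ((-1) ^ (j + i : ℕ)) by
    simp only [map_pow, map_neg, map_one], coeff_C_mul, h]

variable {m : ℕ} {X₀ X₁ Y : Matrix (Fin (m + 1)) (Fin (m + 1)) S} {Θ : S →+* S[X]}

/-- Let `Θ` encode a grading of `S`, sending a homogeneous `p` of degree `d` to `p T ^ d`, and let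
the matrix `Y` have entries of degree at most one, with leading part `X₀`.  Then `TraceLift`
passes from `X₀` to `Y`. -/
theorem TraceLift.of_leadingPart [IsDomain S] (hinj : Function.Injective Θ)
    (hΘ : ∀ p d, Θ ((Θ p).coeff d) = C ((Θ p).coeff d) * X ^ d)
    (hX₀ : ∀ i j, Θ (X₀ i j) = C (X₀ i j) * X) (hX₁ : ∀ i j, Θ (X₁ i j) = C (X₁ i j))
    (hY : Y = X₀ + X₁) (hdet : X₀.det ≠ 0) (h₀ : TraceLift X₀) : TraceLift Y := by
  have hΘY : Θ.mapMatrix Y = (X : S[X]) • X₀.map C + X₁.map C := by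
    ext1 i j
    rw [RingHom.mapMatrix_apply, map_apply, hY, add_apply, map_add, hX₀, hX₁, add_apply,
      smul_apply, map_apply, map_apply, smul_eq_mul, mul_comm]
  suffices H : ∀ (d : ℕ) (A : Matrix (Fin (m + 1)) (Fin (m + 1)) S),
      (∀ i j, ∀ e ≥ d, (Θ (A i j)).coeff e = 0) → (A * Y.adjugate).trace = 0 →
      ∃ C D, A = C * Y + Y * D by
    intro A hA
    refine H (∑ i, ∑ j, ((Θ (A i j)).natDegree + 1)) A (fun i j e he => ?_) hA
    refine coeff_eq_zero_of_natDegree_lt (lt_of_lt_of_le (Nat.lt_succ_self _) (le_trans ?_ he))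
    exact (Finset.single_le_sum (f := fun j => (Θ (A i j)).natDegree + 1)
      (fun _ _ => Nat.zero_le _) (Finset.mem_univ j)).trans
      (Finset.single_le_sum (f := fun i => ∑ j, ((Θ (A i j)).natDegree + 1))
      (fun _ _ => Nat.zero_le _) (Finset.mem_univ i))
  have zero : ∀ A : Matrix (Fin (m + 1)) (Fin (m + 1)) S,
      (∀ i j, ∀ e, (Θ (A i j)).coeff e = 0) → A = 0 := by
    intro A hA
    ext i j
    refine hinj ?_
    ext e
    simpa using hA i j e
  intro d
  induction d with
  | zero =>
    intro A hA _
    exact ⟨0, 0, by simpa using zero A fun i j e => hA i j e (Nat.zero_le _)⟩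
  | succ d ih =>
    intro A hA htr
    have hdeg : ∀ i j, (Θ (A i j)).natDegree ≤ d := fun i j =>
      natDegree_le_iff_coeff_eq_zero.mpr fun e he => hA i j e he
    set B : Matrix (Fin (m + 1)) (Fin (m + 1)) S := of fun i j => (Θ (A i j)).coeff d with hB
    have hBtr : (B * X₀.adjugate).trace = 0 := by
      have h := congrArg (fun p => (Θ p).coeff (d + m)) htr
      simp only [trace, diag, mul_apply, map_sum, map_mul, finsetSum_coeff, map_zero,
        coeff_zero] at h
      rw [← h]
      simp only [trace, diag, mul_apply]
      refine Finset.sum_congr rfl fun i _ => Finset.sum_congr rfl fun j _ => ?_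
      have hadj : Θ (Y.adjugate j i) = ((X : S[X]) • X₀.map C + X₁.map C).adjugate j i := by
        rw [← hΘY, ← RingHom.map_adjugate]
        rfl
      rw [hadj, coeff_mul_add_eq_of_natDegree_le (hdeg i j)
        (natDegree_adjugate_X_smul_add_le X₀ X₁ j i), coeff_adjugate_X_smul_add]
      rfl
    obtain ⟨P, Q, hPQ⟩ := h₀ B hBtr
    have hentry : ∀ i j, C (B i j) * (X : S[X]) ^ d =
        (∑ k, Θ (P i k) * C (X₀ k j) + ∑ k, C (X₀ i k) * Θ (Q k j)) * X := by
      intro i j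
      have h1 : Θ (B i j) = C (B i j) * X ^ d := hΘ _ _
      rw [← h1, hPQ]
      simp only [add_apply, mul_apply, map_add, map_sum, map_mul, hX₀, add_mul, Finset.sum_mul]
      refine congrArg₂ _ (Finset.sum_congr rfl fun k _ => ?_) (Finset.sum_congr rfl fun k _ => ?_)
      · rw [mul_assoc]
      · rw [mul_right_comm]
    cases d with
    | zero =>
      have hB0 : ∀ i j, B i j = 0 := fun i j => by
        have := congrArg (coeff · 0) (hentry i j)
        simpa using this
      refine ⟨0, 0, ?_⟩
      simp only [zero_mul, mul_zero, add_zero]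
      refine zero A fun i j e => ?_
      rcases Nat.eq_zero_or_pos e with rfl | he
      · exact hB0 i j
      · exact hA i j e he
    | succ d =>
      set P' : Matrix (Fin (m + 1)) (Fin (m + 1)) S := of fun i j => (Θ (P i j)).coeff d with hP'
      set Q' : Matrix (Fin (m + 1)) (Fin (m + 1)) S := of fun i j => (Θ (Q i j)).coeff d with hQ'
      have hB' : B = P' * X₀ + X₀ * Q' := by
        ext i j
        have := congrArg (coeff · (d + 1)) (hentry i j)
        simpa [finsetSum_coeff, mul_apply, coeff_mul_X, hP', hQ'] using this
      have htr0 : P.trace + Q.trace = 0 := by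
        have h : X₀.det * (P.trace + Q.trace) = 0 := by
          rw [← hBtr, hPQ, add_mul, trace_add, Matrix.mul_assoc, mul_adjugate, Matrix.mul_assoc,
            trace_mul_comm X₀, Matrix.mul_assoc, adjugate_mul]
          simp [mul_add]
        exact (mul_eq_zero.mp h).resolve_left hdet
      have htr' : P'.trace + Q'.trace = 0 := by
        have := congrArg (fun p => (Θ p).coeff d) htr0
        simpa [trace, finsetSum_coeff, hP', hQ'] using this
      obtain ⟨C', D', hCD⟩ := ih (A - (P' * Y + Y * Q')) (by
        intro i j e he
        have hP : ∀ i k, Θ (P' i k) = C (P' i k) * X ^ d := fun i k => hΘ _ _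
        have hQ : ∀ i k, Θ (Q' i k) = C (Q' i k) * X ^ d := fun i k => hΘ _ _
        have hYe : ∀ i k, Θ (Y i k) = C (X₀ i k) * X + C (X₁ i k) := fun i k => by
          rw [hY, add_apply, map_add, hX₀, hX₁]
        have hsum : Θ ((P' * Y + Y * Q') i j) =
            C (B i j) * X ^ (d + 1) + C ((P' * X₁ + X₁ * Q') i j) * X ^ d := by
          rw [hB']
          simp only [add_apply, mul_apply, map_add, map_sum, map_mul, hP, hQ, hYe, add_mul,
            Finset.sum_mul, mul_add, Finset.sum_add_distrib]
          simp only [pow_succ]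
          have e1 : ∀ k, C (P' i k) * X ^ d * (C (X₀ k j) * X) =
            C (P' i k) * C (X₀ k j) * (X ^ d * X) := fun k => by ring
          have e2 : ∀ k, C (P' i k) * X ^ d * C (X₁ k j) =
            C (P' i k) * C (X₁ k j) * X ^ d := fun k => by ring
          have e3 : ∀ k, C (X₀ i k) * X * (C (Q' k j) * X ^ d) =
            C (X₀ i k) * C (Q' k j) * (X ^ d * X) := fun k => by ring
          have e4 : ∀ k, C (X₁ i k) * (C (Q' k j) * X ^ d) =
            C (X₁ i k) * C (Q' k j) * X ^ d := fun k => by ring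
          simp only [e1, e2, e3, e4]
          ring
        rw [sub_apply, map_sub, hsum, coeff_sub, coeff_add, coeff_C_mul, coeff_C_mul,
          coeff_X_pow, coeff_X_pow, if_neg (by omega : e ≠ d), mul_zero, add_zero]
        rcases eq_or_ne e (d + 1) with rfl | hne
        · simp [hB]
        · rw [if_neg hne, hA i j e (by omega), mul_zero, sub_zero]) (by
        rw [sub_mul, trace_sub, htr, add_mul, trace_add, Matrix.mul_assoc, mul_adjugate,
          Matrix.mul_assoc, trace_mul_comm Y, Matrix.mul_assoc, adjugate_mul]
        simp only [mul_smul_comm, mul_one, trace_smul, ← smul_add, htr']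
        simp)
      refine ⟨C' + P', D' + Q', ?_⟩
      rw [sub_eq_iff_eq_add] at hCD
      rw [hCD, add_mul, mul_add]
      abel

end Degeneration

end Matrix

namespace MvPolynomial

variable {σ R : Type*} [CommRing R]

/-- The ring homomorphism encoding the grading in which the variables in `W` have degree one and
all others have degree zero. -/
def gradingHom (W : Set σ) [DecidablePred (· ∈ W)] :
    MvPolynomial σ R →+* Polynomial (MvPolynomial σ R) :=
  (aeval fun p => if p ∈ W then Polynomial.C (X p) * Polynomial.X else Polynomial.C (X p) :
    MvPolynomial σ R →ₐ[R] Polynomial (MvPolynomial σ R)).toRingHom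

section

variable (W : Set σ) [DecidablePred (· ∈ W)]

theorem gradingHom_C (r : R) :
    gradingHom W (C r : MvPolynomial σ R) = Polynomial.C (C r) := by
  simp [gradingHom, Polynomial.algebraMap_apply, algebraMap_eq]

theorem gradingHom_X_of_mem {p : σ} (hp : p ∈ W) :
    gradingHom W (X p : MvPolynomial σ R) = Polynomial.C (X p) * Polynomial.X := by
  simp [gradingHom, hp]

theorem gradingHom_X_of_notMem {p : σ} (hp : p ∉ W) :
    gradingHom W (X p : MvPolynomial σ R) = Polynomial.C (X p) := by
  simp [gradingHom, hp]

theorem gradingHom_injective :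
    Function.Injective (gradingHom W : MvPolynomial σ R →+* Polynomial (MvPolynomial σ R)) := by
  refine Function.LeftInverse.injective (g := Polynomial.evalRingHom 1) fun a => ?_
  induction a using MvPolynomial.induction_on with
  | C r => simp [gradingHom_C]
  | add a b ha hb => rw [map_add, map_add, ha, hb]
  | mul_X a p ha =>
    rw [map_mul, map_mul, ha]
    by_cases hp : p ∈ W
    · simp [gradingHom_X_of_mem W hp]
    · simp [gradingHom_X_of_notMem W hp]

theorem gradingHom_coeff (a : MvPolynomial σ R) (d : ℕ) :
    gradingHom W ((gradingHom W a).coeff d) =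
      Polynomial.C ((gradingHom W a).coeff d) * Polynomial.X ^ d := by
  induction a using MvPolynomial.induction_on generalizing d with
  | C r =>
    rw [gradingHom_C, Polynomial.coeff_C]
    split_ifs with h <;> simp [h, gradingHom_C]
  | add a b ha hb => rw [map_add, Polynomial.coeff_add, map_add, ha, hb, map_add, add_mul]
  | mul_X a p ha =>
    by_cases hp : p ∈ W
    · rw [map_mul, gradingHom_X_of_mem W hp, ← mul_assoc]
      cases d with
      | zero => simp
      | succ d =>
        rw [Polynomial.coeff_mul_X, Polynomial.coeff_mul_C, map_mul, ha,
          gradingHom_X_of_mem W hp, map_mul]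
        ring
    · rw [map_mul, gradingHom_X_of_notMem W hp, Polynomial.coeff_mul_C, map_mul, ha,
        gradingHom_X_of_notMem W hp, map_mul]
      ring

end

/-- The substitution setting the variable `p₀` to zero. -/
def killVar [DecidableEq σ] (p₀ : σ) : MvPolynomial σ R →+* MvPolynomial σ R :=
  (aeval fun p => if p = p₀ then 0 else X p :
    MvPolynomial σ R →ₐ[R] MvPolynomial σ R).toRingHom

section

variable [DecidableEq σ]

theorem killVar_X (p₀ p : σ) :
    killVar p₀ (X p : MvPolynomial σ R) = if p = p₀ then 0 else X p := by
  simp [killVar]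

theorem X_dvd_sub_killVar (p₀ : σ) (a : MvPolynomial σ R) : X p₀ ∣ a - killVar p₀ a := by
  induction a using MvPolynomial.induction_on with
  | C r => simp [killVar, algebraMap_eq]
  | add a b ha hb =>
    rw [map_add, add_sub_add_comm]
    exact dvd_add ha hb
  | mul_X a p ha =>
    rw [map_mul, killVar_X]
    split_ifs with h
    · simp [h]
    · rw [← sub_mul]
      exact Dvd.dvd.mul_right ha _

end

end MvPolynomial

namespace Matrix

section Tridiagonal

variable {S : Type*} [CommRing S] {n : ℕ}

/-- The tridiagonal matrix with diagonal `f`, constant superdiagonal `y` and constant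
subdiagonal `z`. -/
def tridiagonal (f : Fin n → S) (y z : S) : Matrix (Fin n) (Fin n) S :=
  of fun i j => if i = j then f i else if (i : ℕ) + 1 = j then y
    else if (j : ℕ) + 1 = i then z else 0

theorem tridiagonal_apply (f : Fin n → S) (y z : S) (i j : Fin n) :
    tridiagonal f y z i j = if i = j then f i else if (i : ℕ) + 1 = j then y
      else if (j : ℕ) + 1 = i then z else 0 :=
  rfl

theorem transpose_tridiagonal (f : Fin n → S) (y z : S) :
    (tridiagonal f y z)ᵀ = tridiagonal f z y := by
  ext i j
  simp only [transpose_apply, tridiagonal_apply]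
  split_ifs <;> first | rfl | omega | simp_all

theorem tridiagonal_zero_zero (f : Fin n → S) : tridiagonal f 0 0 = diagonal f := by
  ext i j
  simp [tridiagonal_apply, diagonal_apply]

theorem mapMatrix_tridiagonal {S' : Type*} [CommRing S'] (ρ : S →+* S') (f : Fin n → S) (y z : S) :
    ρ.mapMatrix (tridiagonal f y z) = tridiagonal (fun i => ρ (f i)) (ρ y) (ρ z) := by
  ext i j
  simp only [RingHom.mapMatrix_apply, map_apply, tridiagonal_apply]
  split_ifs <;> simp

theorem det_tridiagonal_zero (f : Fin n → S) (z : S) :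
    (tridiagonal f 0 z).det = ∏ i, f i := by
  rw [det_of_isLowerTriangular]
  · simp [tridiagonal_apply]
  · intro i j hij
    have hij : i < j := hij
    rw [tridiagonal_apply, if_neg hij.ne]
    split_ifs <;> first | rfl | omega

theorem adjugate_tridiagonal_last_zero (f : Fin (n + 1) → S) (y z : S) :
    (tridiagonal f y z).adjugate (Fin.last n) 0 ^ 2 = z ^ (2 * n) := by
  rw [adjugate_fin_succ_eq_det_submatrix, det_of_isUpperTriangular]
  · have : ∀ i : Fin n, (tridiagonal f y z) i.succ i.castSucc = z := fun i => by
      rw [tridiagonal_apply, if_neg, if_neg, if_pos] <;> (simp [Fin.ext_iff]; try omega)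
    simp [this, mul_pow, ← pow_mul, mul_comm]
  · intro i j hij
    have hij : j < i := hij
    have h : (j : ℕ) < i := hij
    simp only [submatrix_apply, Fin.succAbove_zero, Fin.succAbove_last, tridiagonal_apply,
      Fin.ext_iff, Fin.val_succ, Fin.val_castSucc]
    rw [if_neg, if_neg, if_neg] <;> omega

theorem adjugate_tridiagonal_zero_last (f : Fin (n + 1) → S) (y z : S) :
    (tridiagonal f y z).adjugate 0 (Fin.last n) ^ 2 = y ^ (2 * n) := by
  rw [← adjugate_tridiagonal_last_zero f z y, ← transpose_tridiagonal f y z,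
    ← adjugate_transpose]
  rfl

end Tridiagonal

section Generic

open MvPolynomial

variable (K : Type*) [CommRing K] (m : ℕ)

/-- The tridiagonal matrix on the diagonal variables, with superdiagonal entries `x₀₁` and
subdiagonal entries `x₁₀`. -/
def genericTridiagonal :
    Matrix (Fin (m + 2)) (Fin (m + 2)) (MvPolynomial (Fin (m + 2) × Fin (m + 2)) K) :=
  tridiagonal (fun i => X (i, i)) (X (0, 1)) (X (1, 0))

/-- The variables occurring in `genericTridiagonal`. -/
def tridiagonalVars : Set (Fin (m + 2) × Fin (m + 2)) :=
  {p | p.1 = p.2 ∨ p = (0, 1) ∨ p = (1, 0)}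

instance : DecidablePred (· ∈ tridiagonalVars m) := fun p =>
  inferInstanceAs (Decidable (p.1 = p.2 ∨ p = (0, 1) ∨ p = (1, 0)))

variable {K m}

theorem genericTridiagonal_apply_of_mem {i j : Fin (m + 2)} (h : (i, j) ∈ tridiagonalVars m) :
    genericTridiagonal K m i j = X (i, j) := by
  rcases h with h | h | h
  · obtain rfl : i = j := h
    simp [genericTridiagonal, tridiagonal_apply]
  · obtain ⟨rfl, rfl⟩ := Prod.mk.inj h
    simp [genericTridiagonal, tridiagonal_apply]
  · obtain ⟨rfl, rfl⟩ := Prod.mk.inj h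
    simp [genericTridiagonal, tridiagonal_apply]

theorem genericTridiagonal_apply_eq (i j : Fin (m + 2)) :
    genericTridiagonal K m i j = 0 ∨
      ∃ p ∈ tridiagonalVars m, genericTridiagonal K m i j = X p := by
  simp only [genericTridiagonal, tridiagonal_apply]
  split_ifs
  · exact Or.inr ⟨_, Or.inl rfl, rfl⟩
  · exact Or.inr ⟨_, Or.inr (Or.inl rfl), rfl⟩
  · exact Or.inr ⟨_, Or.inr (Or.inr rfl), rfl⟩
  · exact Or.inl rfl

theorem killVar_genericTridiagonal :
    (killVar (0, 1)).mapMatrix (genericTridiagonal K m) =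
      tridiagonal (fun i => X (i, i)) 0 (X (1, 0)) := by
  rw [genericTridiagonal, mapMatrix_tridiagonal]
  congr 1
  · funext i
    rw [killVar_X, if_neg]
    rintro h
    obtain ⟨rfl, h⟩ := Prod.mk.inj h
    simp at h
  · simp [killVar_X]
  · simp [killVar_X]

theorem killVar_lowerBidiagonal :
    (killVar (1, 0)).mapMatrix (tridiagonal (fun i => X (i, i)) 0 (X (1, 0)) :
      Matrix (Fin (m + 2)) (Fin (m + 2)) (MvPolynomial (Fin (m + 2) × Fin (m + 2)) K)) =
      tridiagonal (fun i => X (i, i)) 0 0 := by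
  rw [mapMatrix_tridiagonal]
  congr 1
  · funext i
    rw [killVar_X, if_neg]
    rintro h
    obtain ⟨rfl, h⟩ := Prod.mk.inj h
    simp at h
  · simp [killVar_X]

variable [IsDomain K]

theorem prod_X_diag_ne_zero :
    ∏ i : Fin (m + 2), (X (i, i) : MvPolynomial (Fin (m + 2) × Fin (m + 2)) K) ≠ 0 :=
  Finset.prod_ne_zero_iff.mpr fun _ _ => X_ne_zero _

theorem scalarEnd_lowerBidiagonal :
    ScalarEnd (tridiagonal (fun i => X (i, i)) 0 (X (1, 0)) :
      Matrix (Fin (m + 2)) (Fin (m + 2)) (MvPolynomial (Fin (m + 2) × Fin (m + 2)) K)) := by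
  refine scalarEnd_of_pow (f := X (1, 0)) (ρ := killVar (1, 0)) (X_ne_zero _) (by simp [killVar_X])
    (X_dvd_sub_killVar _) ?_ ?_ 0 (Fin.last _) _ (adjugate_tridiagonal_last_zero _ _ _)
  · rw [killVar_lowerBidiagonal, det_tridiagonal_zero]
    exact prod_X_diag_ne_zero
  · rw [killVar_lowerBidiagonal, tridiagonal_zero_zero]
    refine annihilatorEqDet_diagonal _ (fun i => X_prime) fun i j hij h => hij ?_
    exact congrArg Prod.fst (X_dvd_X.mp h)

theorem traceLift_genericTridiagonal : TraceLift (genericTridiagonal K m) := by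
  refine traceLift_of_pow (f := X (0, 1)) (ρ := killVar (0, 1)) (X_ne_zero _) (by simp [killVar_X])
    (X_dvd_sub_killVar _) ?_ ?_ (Fin.last _) 0 _ (adjugate_tridiagonal_zero_last _ _ _)
  · rw [killVar_genericTridiagonal, det_tridiagonal_zero]
    exact prod_X_diag_ne_zero
  · rw [killVar_genericTridiagonal]
    exact scalarEnd_lowerBidiagonal

theorem det_genericTridiagonal_ne_zero : (genericTridiagonal K m).det ≠ 0 := by
  intro h
  have := congrArg (killVar (0, 1)) h
  rw [RingHom.map_det, killVar_genericTridiagonal, det_tridiagonal_zero, map_zero] at this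
  exact prod_X_diag_ne_zero this

theorem traceLift_genericMatrix : TraceLift (genericMatrix K (m + 2)) := by
  set c : Fin (m + 2) × Fin (m + 2) → MvPolynomial (Fin (m + 2) × Fin (m + 2)) K :=
    fun p => if p ∈ tridiagonalVars m then 0 else genericTridiagonal K m p.1 p.2 with hc
  set ψ := (aeval fun p => X p + c p : MvPolynomial _ K →ₐ[K] MvPolynomial _ K) with hψ
  set ψ' := (aeval fun p => X p - c p : MvPolynomial _ K →ₐ[K] MvPolynomial _ K) with hψ'
  have hψc : ∀ p, ψ' (c p) = c p := by
    intro p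
    simp only [hc]
    split_ifs with hp
    · simp
    · obtain h | ⟨q, hq, h⟩ := genericTridiagonal_apply_eq (K := K) p.1 p.2
      · simp [h]
      · rw [h, hψ', aeval_X]
        simp [hc, hq]
  have hinv : ∀ a, ψ' (ψ a) = a := by
    intro a
    have : ψ'.comp ψ = AlgHom.id K _ := by
      refine algHom_ext fun p => ?_
      rw [AlgHom.comp_apply, hψ, aeval_X, map_add, hψc, hψ', aeval_X]
      simp
    exact DFunLike.congr_fun this a
  have hY : TraceLift (ψ.toRingHom.mapMatrix (genericMatrix K (m + 2))) := by
    refine TraceLift.of_leadingPart (Θ := gradingHom (tridiagonalVars m))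
      (X₀ := genericTridiagonal K m)
      (X₁ := of fun i j => if (i, j) ∈ tridiagonalVars m then 0 else X (i, j))
      (gradingHom_injective _) (gradingHom_coeff _) ?_ ?_ ?_ det_genericTridiagonal_ne_zero
      traceLift_genericTridiagonal
    · intro i j
      obtain h | ⟨q, hq, h⟩ := genericTridiagonal_apply_eq (K := K) i j
      · simp [h]
      · rw [h, gradingHom_X_of_mem _ hq]
    · intro i j
      rw [of_apply]
      split_ifs with h
      · simp
      · rw [gradingHom_X_of_notMem _ h]
    · ext1 i j
      have : ψ (X (i, j)) = X (i, j) + c (i, j) := aeval_X _ _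
      simp only [RingHom.mapMatrix_apply, map_apply, genericMatrix, of_apply, add_apply]
      refine this.trans ?_
      simp only [hc]
      split_ifs with h
      · rw [genericTridiagonal_apply_of_mem h]
      · exact add_comm _ _
  intro A hA
  obtain ⟨P, Q, h⟩ := hY (ψ.toRingHom.mapMatrix A) (by
    rw [← RingHom.map_adjugate, ← map_mul, RingHom.mapMatrix_apply,
      ← AddMonoidHom.map_trace, hA, map_zero])
  have hinv' : ∀ M : Matrix (Fin (m + 2)) (Fin (m + 2)) _,
      ψ'.toRingHom.mapMatrix (ψ.toRingHom.mapMatrix M) = M := by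
    intro M
    ext1 i j
    exact hinv _
  refine ⟨ψ'.toRingHom.mapMatrix P, ψ'.toRingHom.mapMatrix Q, ?_⟩
  have := congrArg ψ'.toRingHom.mapMatrix h
  rwa [map_add, map_mul, map_mul, hinv', hinv'] at this

end Generic

section AnnihilatorDegeneration

open Polynomial

variable {S : Type*} [CommRing S] {m : ℕ} {X₀ X₁ Y : Matrix (Fin (m + 1)) (Fin (m + 1)) S}
  {Θ : S →+* S[X]}

/-- In the situation of `TraceLift.of_leadingPart`, the property `AnnihilatorEqDet` also passes
from the leading part `X₀` to `Y`. -/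
theorem AnnihilatorEqDet.of_leadingPart [IsDomain S] (hinj : Function.Injective Θ)
    (hΘ : ∀ p d, Θ ((Θ p).coeff d) = C ((Θ p).coeff d) * X ^ d)
    (hX₀ : ∀ i j, Θ (X₀ i j) = C (X₀ i j) * X) (hX₁ : ∀ i j, Θ (X₁ i j) = C (X₁ i j))
    (hY : Y = X₀ + X₁) (hdet : X₀.det ≠ 0) (h₀ : AnnihilatorEqDet X₀) : AnnihilatorEqDet Y := by
  have hΘY : Θ.mapMatrix Y = (X : S[X]) • X₀.map C + X₁.map C := by
    ext1 i j
    rw [RingHom.mapMatrix_apply, map_apply, hY, add_apply, map_add, hX₀, hX₁, add_apply,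
      smul_apply, map_apply, map_apply, smul_eq_mul, mul_comm]
  have hadj : ∀ i j, Θ (Y.adjugate i j) = ((X : S[X]) • X₀.map C + X₁.map C).adjugate i j := by
    intro i j
    rw [← hΘY, ← RingHom.map_adjugate]
    rfl
  have hΘdet : Θ Y.det = ((X : S[X]) • X₀.map C + X₁.map C).det := by
    rw [RingHom.map_det, hΘY]
  have hdeg : (Θ Y.det).natDegree ≤ m + 1 := by
    simpa [hΘdet] using natDegree_det_X_add_C_le X₀ X₁
  have hcoeff : (Θ Y.det).coeff (m + 1) = X₀.det := by
    simpa [hΘdet] using coeff_det_X_add_C_card X₀ X₁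
  have hdeg' : (Θ Y.det).natDegree = m + 1 :=
    natDegree_eq_of_le_of_coeff_ne_zero hdeg (by rwa [hcoeff])
  have hΘdet₀ : Θ X₀.det = C X₀.det * X ^ (m + 1) := by
    rw [← hcoeff, hΘ]
  have hYdet : Θ Y.det ≠ 0 := fun h => hdet (by rw [← hcoeff, h, coeff_zero])
  suffices H : ∀ (d : ℕ) (s : S) (E : Matrix (Fin (m + 1)) (Fin (m + 1)) S),
      (∀ e ≥ d, (Θ s).coeff e = 0) → s • 1 = Y * E → Y.det ∣ s by
    intro s E h
    refine H ((Θ s).natDegree + 1) s E (fun e he => ?_) h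
    exact coeff_eq_zero_of_natDegree_lt he
  intro d
  induction d with
  | zero =>
    intro s E hs _
    have : s = 0 := hinj (by ext e; simpa using hs e (Nat.zero_le _))
    exact this ▸ dvd_zero _
  | succ d ih =>
    intro s E hs h
    have hsd : (Θ s).natDegree ≤ d := natDegree_le_iff_coeff_eq_zero.mpr fun e he => hs e he
    have hE : ∀ i j, ∀ e ≥ d, (Θ (E i j)).coeff e = 0 := by
      intro i j e he
      have h1 : s * Y.adjugate i j = Y.det * E i j := by
        have h2 : s • Y.adjugate = Y.det • E := by
          rw [← Matrix.one_mul E, ← smul_mul_assoc, ← adjugate_mul, Matrix.mul_assoc, ← h,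
            mul_smul_comm, Matrix.mul_one]
        exact congrFun (congrFun h2 i) j
      by_cases hE0 : Θ (E i j) = 0
      · simp [hE0]
      refine coeff_eq_zero_of_natDegree_lt (lt_of_lt_of_le ?_ he)
      have h2 := congrArg (fun p => (Θ p).natDegree) h1
      simp only [map_mul] at h2
      rw [natDegree_mul hYdet hE0, hdeg', hadj] at h2
      have h3 := natDegree_mul_le (p := Θ s)
        (q := ((X : S[X]) • X₀.map C + X₁.map C).adjugate i j)
      have h4 := natDegree_adjugate_X_smul_add_le X₀ X₁ i j
      omega
    have hlead : ∃ E', (Θ s).coeff d • (1 : Matrix (Fin (m + 1)) (Fin (m + 1)) S) = X₀ * E' := by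
      have hk : ∀ i j, (Θ s * if i = j then 1 else 0).coeff d =
          ∑ k, (X₀ i k * (X * Θ (E k j)).coeff d + X₁ i k * (Θ (E k j)).coeff d) := by
        intro i j
        have h1 := congrArg Θ (congrFun (congrFun h i) j)
        simp only [smul_apply, one_apply, mul_apply, smul_eq_mul, map_mul, map_sum, hY,
          add_apply, map_add, hX₀, hX₁, apply_ite Θ, map_one, map_zero] at h1
        rw [h1, finsetSum_coeff]
        refine Finset.sum_congr rfl fun k _ => ?_
        rw [add_mul, coeff_add, mul_assoc, coeff_C_mul, coeff_C_mul]
      have hsimp : ∀ i j, (Θ s * if i = j then 1 else 0).coeff d =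
          ((Θ s).coeff d • (1 : Matrix (Fin (m + 1)) (Fin (m + 1)) S)) i j := by
        intro i j
        by_cases hij : i = j <;> simp [hij]
      refine ⟨of fun k j => (X * Θ (E k j)).coeff d, ?_⟩
      ext i j
      rw [← hsimp, hk, mul_apply]
      refine Finset.sum_congr rfl fun k _ => ?_
      rw [hE k j d le_rfl, mul_zero, add_zero, of_apply]
    obtain ⟨E', hE'⟩ := hlead
    obtain ⟨u, hu⟩ := h₀ _ _ hE'
    by_cases hu0 : u = 0
    · refine ih s E (fun e he => ?_) h
      rcases eq_or_lt_of_le he with rfl | he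
      · rw [hu, hu0, mul_zero]
      · exact hs e he
    have hΘu : Θ u * X ^ (m + 1) = C u * X ^ d := by
      have h1 := hΘ s d
      rw [hu, map_mul, hΘdet₀, map_mul] at h1
      refine mul_left_cancel₀ (C_ne_zero.mpr hdet) ?_
      linear_combination h1
    have hdegu : (Θ u).natDegree + (m + 1) = d := by
      have h1 := congrArg natDegree hΘu
      rwa [natDegree_mul_X_pow _ (by simpa using fun h => hu0 (hinj (by simpa using h))),
        natDegree_C_mul_X_pow _ _ hu0] at h1
    have hcu : (Θ u).coeff (Θ u).natDegree = u := by
      have h1 := congrArg (coeff · d) hΘu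
      simpa [← hdegu, coeff_mul_X_pow, -coeff_natDegree] using h1
    have hlow : ∀ e ≥ d, (Θ (s - Y.det * u)).coeff e = 0 := by
      intro e he
      rw [map_sub, coeff_sub, map_mul, sub_eq_zero]
      rcases eq_or_lt_of_le he with rfl | he
      · rw [hu, ← hdegu, mul_comm (Θ Y.det), coeff_mul_add_eq_of_natDegree_le le_rfl hdeg, hcoeff,
          hcu, mul_comm]
      · rw [hs e he, coeff_eq_zero_of_natDegree_lt]
        exact natDegree_mul_le.trans_lt (by omega)
    have := ih (s - Y.det * u) (E - u • Y.adjugate) hlow (by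
      rw [mul_sub, ← h, mul_smul_comm, mul_adjugate]
      module)
    simpa using dvd_add this (dvd_mul_right Y.det u)

end AnnihilatorDegeneration

section GenericAnnihilator

open MvPolynomial

variable {K : Type*} [CommRing K] [IsDomain K] {m : ℕ}

theorem annihilatorEqDet_genericMatrix : AnnihilatorEqDet (genericMatrix K (m + 1)) := by
  classical
  refine AnnihilatorEqDet.of_leadingPart
    (Θ := gradingHom {p : Fin (m + 1) × Fin (m + 1) | p.1 = p.2})
    (X₀ := diagonal fun i => X (i, i)) (X₁ := of fun i j => if i = j then 0 else X (i, j))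
    (gradingHom_injective _) (gradingHom_coeff _) ?_ ?_ ?_ ?_ ?_
  · intro i j
    by_cases h : i = j
    · subst h
      rw [diagonal_apply_eq, gradingHom_X_of_mem _ (by rfl)]
    · simp [diagonal_apply_ne _ h]
  · intro i j
    rw [of_apply]
    split_ifs with h
    · simp
    · rw [gradingHom_X_of_notMem {p : Fin (m + 1) × Fin (m + 1) | p.1 = p.2} h]
  · ext1 i j
    by_cases h : i = j
    · subst h
      simp [genericMatrix]
    · simp [genericMatrix, h]
  · rw [det_diagonal]
    exact Finset.prod_ne_zero_iff.mpr fun _ _ => X_ne_zero _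
  · refine annihilatorEqDet_diagonal _ (fun i => X_prime) fun i j hij h => hij ?_
    exact congrArg Prod.fst (X_dvd_X.mp h)

theorem det_genericMatrix_ne_zero {n : ℕ} : (genericMatrix K n).det ≠ 0 := by
  intro h
  have h1 := congrArg (eval fun p : Fin n × Fin n => if p.1 = p.2 then (1 : K) else 0) h
  rw [RingHom.map_det, map_zero] at h1
  have h2 : (eval fun p : Fin n × Fin n => if p.1 = p.2 then (1 : K) else 0).mapMatrix
      (genericMatrix K n) = 1 := by
    ext i j
    simp [genericMatrix, one_apply]
  rw [h2, det_one] at h1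
  exact one_ne_zero h1

end GenericAnnihilator

section Lifting

variable {n S : Type*} [Fintype n] [DecidableEq n] [CommRing S]

theorem det_dvd_adjugate_mul_sub (X : Matrix n n S) (i j k l : n) :
    X.det ∣ X.adjugate j i * X.adjugate k l - X.adjugate j l * X.adjugate k i := by
  obtain ⟨w, hw⟩ := exists_mulVec_eq_adjugate_smul_sub X i j l
  refine ⟨w k, ?_⟩
  have h := congrFun (congrArg (X.adjugate *ᵥ ·) hw) k
  simp only [mulVec_mulVec, adjugate_mul, smul_mulVec, one_mulVec, mulVec_sub, mulVec_smul,
    mulVec_single_one, Pi.smul_apply, Pi.sub_apply, smul_eq_mul, col_apply] at h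
  exact h.symm

theorem det_dvd_adjugate_mul_trace {X A B : Matrix n n S} (h : A * X.adjugate = X * B) (k l : n) :
    X.det ∣ X.adjugate k l * (A * X.adjugate).trace := by
  have h1 : (X.adjugate * A * X.adjugate) k l = X.det * B k l := by
    rw [Matrix.mul_assoc, h, ← Matrix.mul_assoc, adjugate_mul]
    simp
  have h2 : X.adjugate k l * (A * X.adjugate).trace = X.det * B k l +
      ∑ j, ∑ i, A i j *
        (X.adjugate j i * X.adjugate k l - X.adjugate j l * X.adjugate k i) := by
    rw [← h1]
    simp only [trace, diag, mul_apply, Finset.sum_mul, Finset.mul_sum]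
    rw [Finset.sum_comm, ← Finset.sum_add_distrib]
    refine Finset.sum_congr rfl fun j _ => ?_
    rw [← Finset.sum_add_distrib]
    refine Finset.sum_congr rfl fun i _ => ?_
    ring
  rw [h2]
  exact dvd_add (dvd_mul_right _ _) (Finset.dvd_sum fun j _ => Finset.dvd_sum fun i _ =>
    Dvd.dvd.mul_left (det_dvd_adjugate_mul_sub X i j k l) _)

/-- A homomorphism from the free module to the cokernel of `X` (given by a matrix `A`) that
vanishes on the image of `adj X` factors through `X`. -/
theorem exists_eq_mul_add_mul [Nonempty n] [IsDomain S] {X A B : Matrix n n S} (hdet : X.det ≠ 0)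
    (hT : TraceLift X) (hA : AnnihilatorEqDet X) (h : A * X.adjugate = X * B) :
    ∃ C D, A = C * X + X * D := by
  set t := (A * X.adjugate).trace with ht
  choose U hU using fun k l => det_dvd_adjugate_mul_trace h k l
  obtain ⟨c, hc⟩ : X.det ∣ t := by
    refine hA t (of U) ((smul_right_inj hdet).mp ?_)
    have : t • X.adjugate = X.det • of U := by
      ext k l
      simp [← hU, ht, mul_comm]
    rw [← mul_smul_comm, ← this, mul_smul_comm, mul_adjugate, smul_comm]
  obtain ⟨i⟩ := ‹Nonempty n›
  obtain ⟨C, D, hCD⟩ := hT (A - (c • single i i 1) * X) (by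
    rw [sub_mul, trace_sub, ← ht, hc, Matrix.mul_assoc, mul_adjugate]
    simp [mul_comm])
  refine ⟨C + c • single i i 1, D, ?_⟩
  rw [sub_eq_iff_eq_add] at hCD
  rw [hCD, add_mul]
  abel

end Lifting

end Matrix

namespace CategoryTheory

open HomologicalComplex

universe u

variable {R M : Type u} [CommRing R] [AddCommGroup M] [Module R M] {f g : M →ₗ[R] M}

/-- The two-periodic complex `⋯ ⟶ M --f--> M --g--> M --f--> M`. -/
abbrev periodicComplex (hfg : f ∘ₗ g = 0) (hgf : g ∘ₗ f = 0) : ChainComplex (ModuleCat.{u} R) ℕ :=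
  alternatingConst (ModuleCat.of R M) (φ := ModuleCat.ofHom g) (ψ := ModuleCat.ofHom f)
    (by rw [← ModuleCat.ofHom_comp, hfg]; rfl) (by rw [← ModuleCat.ofHom_comp, hgf]; rfl)
    fun _ _ => ComplexShape.down_nat_odd_add

theorem periodicComplex_d_one_zero (hfg : f ∘ₗ g = 0) (hgf : g ∘ₗ f = 0) :
    (periodicComplex hfg hgf).d 1 0 = ModuleCat.ofHom f := by
  simp
  rfl

theorem periodicComplex_d_two_one (hfg : f ∘ₗ g = 0) (hgf : g ∘ₗ f = 0) :
    (periodicComplex hfg hgf).d 2 1 = ModuleCat.ofHom g := by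
  simp
  rfl

/-- The augmentation of `periodicComplex` to the cokernel of `f`. -/
def periodicComplexπ (hfg : f ∘ₗ g = 0) (hgf : g ∘ₗ f = 0) :
    periodicComplex hfg hgf ⟶
      (ChainComplex.single₀ (ModuleCat.{u} R)).obj (ModuleCat.of R (M ⧸ LinearMap.range f)) :=
  ((periodicComplex hfg hgf).toSingle₀Equiv _).symm
    ⟨ModuleCat.ofHom (LinearMap.range f).mkQ, by
      rw [periodicComplex_d_one_zero]
      exact ModuleCat.hom_ext (LinearMap.range_mkQ_comp f)⟩

theorem periodicComplexπ_f_zero (hfg : f ∘ₗ g = 0) (hgf : g ∘ₗ f = 0) :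
    (periodicComplexπ hfg hgf).f 0 = ModuleCat.ofHom (LinearMap.range f).mkQ :=
  ChainComplex.toSingle₀Equiv_symm_apply_f_zero _ _

theorem periodicComplex_quasiIso (hfg : f ∘ₗ g = 0) (hgf : g ∘ₗ f = 0)
    (hf : LinearMap.ker f = LinearMap.range g) (hg : LinearMap.ker g = LinearMap.range f) :
    QuasiIso (periodicComplexπ hfg hgf) where
  quasiIsoAt m := by
    cases m with
    | zero =>
      rw [ChainComplex.quasiIsoAt₀_iff, ShortComplex.quasiIso_iff_of_zeros' _ rfl rfl rfl]
      constructor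
      · rw [ShortComplex.moduleCat_exact_iff_range_eq_ker]
        have h1 : LinearMap.range ((periodicComplex hfg hgf).d 1 0).hom = LinearMap.range f := by
          rw [periodicComplex_d_one_zero]
          rfl
        have h2 : LinearMap.ker ((periodicComplexπ hfg hgf).f 0).hom = LinearMap.range f := by
          rw [periodicComplexπ_f_zero]
          exact Submodule.ker_mkQ _
        exact h1.trans h2.symm
      · change Epi ((periodicComplexπ hfg hgf).f 0)
        rw [ModuleCat.epi_iff_surjective, periodicComplexπ_f_zero]
        exact Submodule.mkQ_surjective _
    | succ m =>
      rw [quasiIsoAt_iff_exactAt' (hL := ChainComplex.exactAt_succ_single_obj ..),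
        exactAt_iff' _ (m + 2) (m + 1) m (by simp) (by simp)]
      rcases Nat.even_or_odd (m + 1) with hm | hm
      · rw [ShortComplex.exact_iff_of_iso (alternatingConstScIsoEven _ _ _ _ (by simp) (by simp) hm),
          ShortComplex.moduleCat_exact_iff_range_eq_ker]
        exact hg.symm
      · rw [ShortComplex.exact_iff_of_iso (alternatingConstScIsoOdd _ _ _ _ (by simp) (by simp) hm),
          ShortComplex.moduleCat_exact_iff_range_eq_ker]
        exact hf.symm

/-- A two-periodic exact complex of projectives resolves its cokernel. -/
def periodicResolution [Module.Projective R M] (hfg : f ∘ₗ g = 0) (hgf : g ∘ₗ f = 0)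
    (hf : LinearMap.ker f = LinearMap.range g) (hg : LinearMap.ker g = LinearMap.range f) :
    ProjectiveResolution (ModuleCat.of R (M ⧸ LinearMap.range f)) where
  complex := periodicComplex hfg hgf
  projective _ := (ModuleCat.of R M).projective_of_categoryTheory_projective
  π := periodicComplexπ hfg hgf
  quasiIso := periodicComplex_quasiIso hfg hgf hf hg

theorem subsingleton_ext_one_of_periodic [Module.Projective R M]
    (hf : LinearMap.ker f = LinearMap.range g) (hg : LinearMap.ker g = LinearMap.range f)
    (N : Type u) [AddCommGroup N] [Module R N]
    (h : ∀ φ : M →ₗ[R] N, φ ∘ₗ g = 0 → ∃ ψ : M →ₗ[R] N, φ = ψ ∘ₗ f) :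
    Subsingleton (((Ext R (ModuleCat.{u} R) 1).obj
      (Opposite.op (ModuleCat.of R (M ⧸ LinearMap.range f)))).obj (ModuleCat.of R N)) := by
  have hfg : f ∘ₗ g = 0 := LinearMap.range_le_ker_iff.mp hf.ge
  have hgf : g ∘ₗ f = 0 := LinearMap.range_le_ker_iff.mp hg.ge
  refine ModuleCat.subsingleton_of_isZero (Limits.IsZero.of_iso ?_
    ((periodicResolution hfg hgf hf hg).isoExt 1 (ModuleCat.of R N)))
  rw [← exactAt_iff_isZero_homology, exactAt_iff' _ 0 1 2 (by simp) (by simp),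
    ShortComplex.moduleCat_exact_iff]
  intro φ hφ
  have h0 : (periodicComplex hfg hgf).d 2 1 ≫
      (show ModuleCat.of R M ⟶ ModuleCat.of R N from φ) = 0 := hφ
  rw [periodicComplex_d_two_one] at h0
  obtain ⟨ψ, hψ⟩ := h (ModuleCat.Hom.hom φ) (congrArg ModuleCat.Hom.hom h0)
  refine ⟨ModuleCat.ofHom ψ, ?_⟩
  have h1 : (periodicComplex hfg hgf).d 1 0 ≫ ModuleCat.ofHom ψ = φ := by
    rw [periodicComplex_d_one_zero]
    exact ModuleCat.hom_ext hψ.symm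
  exact h1

end CategoryTheory

namespace Matrix

section Quotient

theorem exists_eq_smul_of_map_eq_zero {m n S R : Type*} [CommRing S] [CommRing R] {π : S →+* R}
    {d : S} (hker : RingHom.ker π = Ideal.span {d})
    {M : Matrix m n S} (h : M.map π = 0) : ∃ N, M = d • N := by
  have hd : ∀ i j, d ∣ M i j := fun i j => by
    rw [← Ideal.mem_span_singleton, ← hker, RingHom.mem_ker]
    exact congrFun (congrFun h i) j
  choose N hN using hd
  exact ⟨of N, by ext i j; exact hN i j⟩

variable {n S R : Type*} [Fintype n] [DecidableEq n] [CommRing S] [CommRing R] {π : S →+* R}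

/-- The exactness of a matrix factorization modulo `d`. -/
theorem ker_mulVecLin_map_eq_range [IsDomain S] (hπ : Function.Surjective π) {d : S} (hd : d ≠ 0)
    (hker : RingHom.ker π = Ideal.span {d}) {P Q : Matrix n n S} (hPQ : P * Q = d • 1)
    (hQP : Q * P = d • 1) :
    LinearMap.ker (P.map π).mulVecLin = LinearMap.range (Q.map π).mulVecLin := by
  ext v
  rw [LinearMap.mem_ker, LinearMap.mem_range]
  constructor
  · intro hv
    choose v' hv' using fun i => hπ (v i)
    obtain rfl : (fun i => π (v' i)) = v := funext hv'
    have h : ∀ i, d ∣ (P *ᵥ v') i := fun i => by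
      rw [← Ideal.mem_span_singleton, ← hker, RingHom.mem_ker, RingHom.map_mulVec]
      exact congrFun hv i
    choose w hw using h
    have hw : P *ᵥ v' = d • w := funext hw
    have h1 : v' = Q *ᵥ w := by
      refine (smul_right_inj hd).mp ?_
      rw [← mulVec_smul, ← hw, mulVec_mulVec, hQP, smul_mulVec, one_mulVec]
    refine ⟨fun i => π (w i), ?_⟩
    ext i
    rw [h1, RingHom.map_mulVec]
    rfl
  · rintro ⟨w, rfl⟩
    have h0 : P.map π * Q.map π = 0 := by
      have : π d = 0 := by
        rw [← RingHom.mem_ker, hker]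
        exact Ideal.mem_span_singleton_self d
      rw [← Matrix.map_mul, hPQ]
      ext i j
      simp [this]
    rw [mulVecLin_apply, mulVecLin_apply, mulVec_mulVec, h0, zero_mulVec]

theorem exists_eq_comp_mulVecLin [Nonempty n] [IsDomain S] (hπ : Function.Surjective π)
    {X : Matrix n n S} (hker : RingHom.ker π = Ideal.span {X.det}) (hdet : X.det ≠ 0)
    (hT : TraceLift X) (hA : AnnihilatorEqDet X)
    (φ : (n → R) →ₗ[R] (n → R) ⧸ LinearMap.range (X.map π).mulVecLin)
    (hφ : φ ∘ₗ (X.adjugate.map π).mulVecLin = 0) :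
    ∃ ψ : (n → R) →ₗ[R] (n → R) ⧸ LinearMap.range (X.map π).mulVecLin,
      φ = ψ ∘ₗ (X.map π).mulVecLin := by
  set q := (LinearMap.range (X.map π).mulVecLin).mkQ
  have hqX : ∀ v, q (X.map π *ᵥ v) = 0 := fun v =>
    (Submodule.Quotient.mk_eq_zero _).mpr ⟨v, rfl⟩
  choose a ha using fun j => Submodule.mkQ_surjective _ (φ (Pi.single j 1))
  choose A hA' using fun i j => hπ (a j i)
  have hφA : φ = q ∘ₗ ((of A).map π).mulVecLin := by
    refine LinearMap.pi_ext' fun j => LinearMap.ext_ring ?_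
    simp only [LinearMap.comp_apply, LinearMap.coe_single, mulVecLin_apply, mulVec_single_one]
    rw [← ha]
    congr 1
    ext i
    exact (hA' i j).symm
  have hB : ∀ j, ∃ b : n → R, X.map π *ᵥ b = ((of A).map π * X.adjugate.map π).col j := by
    intro j
    have h1 := LinearMap.congr_fun hφ (Pi.single j 1)
    rw [hφA, LinearMap.comp_apply, LinearMap.comp_apply, mulVecLin_apply, mulVecLin_apply,
      mulVec_mulVec, mulVec_single_one, LinearMap.zero_apply] at h1
    exact (Submodule.Quotient.mk_eq_zero _).mp h1
  choose b hb using hB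
  choose B hB using fun i j => hπ (b j i)
  obtain ⟨W, hW⟩ := exists_eq_smul_of_map_eq_zero hker
    (M := of A * X.adjugate - X * of B) (by
      rw [Matrix.map_sub _ (map_sub π), Matrix.map_mul, Matrix.map_mul, sub_eq_zero]
      ext i j
      have h1 := congrFun (hb j) i
      rw [col_apply] at h1
      rw [← h1, mul_apply]
      simp [mulVec, dotProduct, hB])
  obtain ⟨C, D, hCD⟩ := exists_eq_mul_add_mul hdet hT hA
    (A := of A) (B := of B + X.adjugate * W) (by
      rw [mul_add, ← Matrix.mul_assoc, mul_adjugate, smul_mul_assoc, Matrix.one_mul, ← hW]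
      abel)
  refine ⟨q ∘ₗ (C.map π).mulVecLin, ?_⟩
  rw [hφA, hCD, Matrix.map_add _ (map_add π), Matrix.map_mul, Matrix.map_mul]
  refine LinearMap.ext fun v => ?_
  rw [LinearMap.comp_apply, mulVecLin_apply, add_mulVec, map_add, ← mulVec_mulVec,
    ← mulVec_mulVec, hqX, add_zero]
  rfl

end Quotient

end Matrix

set_option synthInstance.maxHeartbeats 1000000 in
set_option maxHeartbeats 1000000 in
/-- Let `K` be a commutative Noetherian normal domain, `n ≥ 2`, `X` the
generic `n × n` matrix over `K`, `R = S/(det X)`, and `L = coker(X̄ : Rⁿ → Rⁿ)`.  Then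
`Ext¹_R(L, L) = 0`, i.e. the `R`-module `L` is rigid. -/
theorem statement13 (K : Type*) [CommRing K] [IsDomain K] [IsNoetherianRing K]
    [IsIntegrallyClosed K] (n : ℕ) (hn : 2 ≤ n) :
    letI R := genericDetRing K n
    letI L := (Fin n → R) ⧸ LinearMap.range (Matrix.mulVecLin (genericMatrixBar K n))
    Subsingleton (((Ext R (ModuleCat R) 1).obj
        (Opposite.op (ModuleCat.of R L))).obj (ModuleCat.of R L)) := by
  obtain ⟨m, rfl⟩ : ∃ m, n = m + 2 := ⟨n - 2, by omega⟩
  have hπ : Function.Surjective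
      (Ideal.Quotient.mk (Ideal.span {(genericMatrix K (m + 2)).det})) :=
    Ideal.Quotient.mk_surjective
  have hker := Ideal.mk_ker (I := Ideal.span {(genericMatrix K (m + 2)).det})
  have hdet : (genericMatrix K (m + 2)).det ≠ 0 := det_genericMatrix_ne_zero
  exact subsingleton_ext_one_of_periodic
    (ker_mulVecLin_map_eq_range hπ hdet hker (mul_adjugate _) (adjugate_mul _))
    (ker_mulVecLin_map_eq_range hπ hdet hker (adjugate_mul _) (mul_adjugate _)) _
    (exists_eq_comp_mulVecLin hπ hker hdet traceLift_genericMatrix annihilatorEqDet_genericMatrix)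

end
end
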